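/- arXiv:2307.01820 — 10 statements merged into one kernel-verified Lean document; each statement's English description precedes it below -/
import Mathlib

section
/- Let ‖·‖ be a strictly convex C^{1,1} norm on ℝ² with unit ball Ω and dual unit ball Ω°; let P, Q be area parametrizations of ∂Ω, ∂Ω°, and C : ℝ → ℝ the nondecreasing correspondence with ⟨P(C(s)), Q(s)⟩ = 1 for all s; assume Q is differentiable everywhere with Q′(s) = (−P₂(C(s)), P₁(C(s))). For φ, ω, r, t define Z(φ,ω,r;t) := (r²t/(2ω²))·(1 − ⟨Q(φ), P(C(φ+ωt))⟩) − (r²/ω³)·(ωt + Q₂(φ)·Q₁(φ+ωt) − Q₁(φ)·Q₂(φ+ωt)) (this is the partial derivative ∂z/∂ω of the third coordinate of the Heisenberg exponential map). Then there exist constants K̄ > 0 and ε̄ > 0 such that for every ε ∈ (0,ε̄), for ℒ¹-almost every φ ∈ ℝ, every r > 0 and every ω ≠ 0, there exist k > 0 and ρ > 0 with |Z(φ,ω,r;t) − k·t³| ≤ K̄·ε·k·|t|³ for all t ∈ [−ρ,ρ]. -/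
open MeasureTheory

/-- A (symmetric) norm on `ℝ × ℝ`. -/
structure IsNorm2 (nrm : ℝ × ℝ → ℝ) : Prop where
  eq_zero_iff : ∀ x, nrm x = 0 ↔ x = 0
  smul_eq : ∀ (a : ℝ) (x : ℝ × ℝ), nrm (a • x) = |a| * nrm x
  triangle : ∀ x y, nrm (x + y) ≤ nrm x + nrm y

/-- `nrm` is `C^{1,1}` on `ℝ² ∖ {0}`: differentiable there, with locally Lipschitz derivative. -/
def IsC11Away (nrm : ℝ × ℝ → ℝ) : Prop :=
  DifferentiableOn ℝ nrm {x | x ≠ 0} ∧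
    ∀ x : ℝ × ℝ, x ≠ 0 → ∃ ε > (0:ℝ), ∃ K : NNReal,
      LipschitzOnWith K (fderiv ℝ nrm) (Metric.ball x ε \ {0})

/-- The Euclidean pairing on `ℝ × ℝ`. -/
def dot2 (p q : ℝ × ℝ) : ℝ := p.1 * q.1 + p.2 * q.2

/-- The polar set of a subset of `ℝ²`. -/
def polar2 (K : Set (ℝ × ℝ)) : Set (ℝ × ℝ) := {q | ∀ x ∈ K, dot2 q x ≤ 1}

/-- The closed unit ball of the norm `nrm`. -/
def unitBall2 (nrm : ℝ × ℝ → ℝ) : Set (ℝ × ℝ) := {x | nrm x ≤ 1}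

/-- An area parametrization of the boundary of `K`: a locally Lipschitz curve tracing
`frontier K` which sweeps area at unit rate, i.e. `R₁ R₂′ − R₂ R₁′ = 1` a.e.
(equivalently `R θ = (cos_K θ, sin_K θ)` in the paper's convex trigonometry). -/
structure IsAreaParam (K : Set (ℝ × ℝ)) (R : ℝ → ℝ × ℝ) : Prop where
  lipschitz : LocallyLipschitz R
  mem_frontier : ∀ θ, R θ ∈ frontier K
  area : ∀ᵐ θ : ℝ ∂volume, ∃ v : ℝ × ℝ, HasDerivAt R v θ ∧ (R θ).1 * v.2 - (R θ).2 * v.1 = 1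

/-- `Z(φ,ω,r;t) = ∂z/∂ω`, the derivative in `ω` of the vertical component of the
exponential map of the sub-Finsler Heisenberg group. -/
noncomputable def Zfun (P Q : ℝ → ℝ × ℝ) (C : ℝ → ℝ) (φ ω r t : ℝ) : ℝ :=
  (r ^ 2 * t / (2 * ω ^ 2)) * (1 - dot2 (Q φ) (P (C (φ + ω * t))))
    - (r ^ 2 / ω ^ 3) *
        (ω * t + (Q φ).2 * (Q (φ + ω * t)).1 - (Q φ).1 * (Q (φ + ω * t)).2)

open Filter Asymptotics Set
open scoped Topology

/-- Integrating a `o(uⁿ)` estimate of the derivative gives a `o(uⁿ⁺¹)` estimate. -/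
theorem isLittleO_pow_succ_of_hasDerivAt {F F' : ℝ → ℝ} {n : ℕ}
    (hF : ∀ u, HasDerivAt F (F' u) u) (h0 : F 0 = 0)
    (ho : F' =o[𝓝 0] fun u => u ^ n) : F =o[𝓝 0] fun u => u ^ (n + 1) := by
  rw [isLittleO_iff]
  intro c hc
  obtain ⟨δ, hδ, hball⟩ := Metric.eventually_nhds_iff_ball.1 (isLittleO_iff.1 ho hc)
  refine Metric.eventually_nhds_iff_ball.2 ⟨δ, hδ, fun u hu => ?_⟩
  have hu' : |u| < δ := by simpa using hu
  have key := (convex_closedBall (0 : ℝ) |u|).norm_image_sub_le_of_norm_hasDerivWithin_le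
    (f := F) (f' := F') (C := c * |u| ^ n) (x := 0) (y := u)
    (fun x _ => (hF x).hasDerivWithinAt)
    (fun x hx => by
      have hx' : |x| ≤ |u| := by simpa using hx
      refine (hball x (by simpa using hx'.trans_lt hu')).trans ?_
      rw [norm_pow, Real.norm_eq_abs]
      gcongr)
    (by simp) (by simp)
  simpa [h0, pow_succ, mul_assoc] using key

section Expansion

variable {x₁ x₂ q₁ q₂ : ℝ → ℝ} {a₁ a₂ : ℝ}

theorem HasDerivAt.isLittleO_sub_pow_one {x : ℝ → ℝ} {a : ℝ} (hx : HasDerivAt x a 0) :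
    (fun u => x u - x 0 - a * u) =o[𝓝 0] fun u => u ^ 1 := by
  simpa [mul_comm] using hasDerivAt_iff_isLittleO.1 hx

/-- Second order expansion of `1 - ⟨q 0, x u⟩` when `q' = J x` and `⟨x, q⟩ = 1`. -/
theorem one_sub_pairing_isLittleO
    (hq₁ : ∀ u, HasDerivAt q₁ (-x₂ u) u) (hq₂ : ∀ u, HasDerivAt q₂ (x₁ u) u)
    (hdot : ∀ u, x₁ u * q₁ u + x₂ u * q₂ u = 1)
    (hx₁ : HasDerivAt x₁ a₁ 0) (hx₂ : HasDerivAt x₂ a₂ 0) :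
    (fun u => 1 - (q₁ 0 * x₁ u + q₂ 0 * x₂ u) - (x₁ 0 * a₂ - x₂ 0 * a₁) / 2 * u ^ 2)
      =o[𝓝 0] fun u => u ^ 2 := by
  have d₁ := hx₁.isLittleO_sub_pow_one
  have d₂ := hx₂.isLittleO_sub_pow_one
  have e₁ : (fun u => q₁ u - q₁ 0 + x₂ 0 * u + a₂ / 2 * u ^ 2) =o[𝓝 0] fun u => u ^ 2 := by
    refine isLittleO_pow_succ_of_hasDerivAt (n := 1)
      (F' := fun u => -(x₂ u - x₂ 0 - a₂ * u)) (fun u => ?_) (by simp) d₂.neg_left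
    refine HasDerivAt.congr_deriv
      ((((hq₁ u).sub_const (q₁ 0)).add
        ((hasDerivAt_id u).const_mul (x₂ 0))).add
      ((hasDerivAt_pow 2 u).const_mul (a₂ / 2))) ?_
    push_cast
    ring
  have e₂ : (fun u => q₂ u - q₂ 0 - x₁ 0 * u - a₁ / 2 * u ^ 2) =o[𝓝 0] fun u => u ^ 2 := by
    refine isLittleO_pow_succ_of_hasDerivAt (n := 1)
      (F' := fun u => x₁ u - x₁ 0 - a₁ * u) (fun u => ?_) (by simp) d₁
    refine HasDerivAt.congr_deriv
      ((((hq₂ u).sub_const (q₂ 0)).sub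
        ((hasDerivAt_id u).const_mul (x₁ 0))).sub
      ((hasDerivAt_pow 2 u).const_mul (a₁ / 2))) ?_
    push_cast
    ring
  have bdd {v : ℝ → ℝ} (hv : ContinuousAt v 0) {e : ℝ → ℝ}
      (he : e =o[𝓝 0] fun u => u ^ 2) : (fun u => v u * e u) =o[𝓝 0] fun u => u ^ 2 := by
    simpa using (hv.tendsto.isBigO_one ℝ).mul_isLittleO he
  have ud {d : ℝ → ℝ} (hd : d =o[𝓝 0] fun u => u ^ 1) :
      (fun u => u * d u) =o[𝓝 0] fun u => u ^ 2 := by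
    refine ((isBigO_refl (fun u : ℝ => u) (𝓝 0)).mul_isLittleO hd).congr_right fun u => ?_
    ring
  have h := (((bdd hx₁.continuousAt e₁).add (bdd hx₂.continuousAt e₂)).sub
    (bdd (v := fun u => x₂ 0 + a₂ / 2 * u) (by fun_prop) (ud d₁))).add
    (bdd (v := fun u => x₁ 0 + a₁ / 2 * u) (by fun_prop) (ud d₂))
  refine h.congr_left fun u => ?_
  linear_combination hdot u

/-- Third order expansion of the function governing `∂z/∂ω`. -/
theorem cubic_expansion_isLittleO
    (hq₁ : ∀ u, HasDerivAt q₁ (-x₂ u) u) (hq₂ : ∀ u, HasDerivAt q₂ (x₁ u) u)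
    (hdot : ∀ u, x₁ u * q₁ u + x₂ u * q₂ u = 1)
    (hx₁ : HasDerivAt x₁ a₁ 0) (hx₂ : HasDerivAt x₂ a₂ 0) :
    (fun u => u / 2 * (1 - (q₁ 0 * x₁ u + q₂ 0 * x₂ u)) - (u + q₂ 0 * q₁ u - q₁ 0 * q₂ u)
      - (x₁ 0 * a₂ - x₂ 0 * a₁) / 12 * u ^ 3) =o[𝓝 0] fun u => u ^ 3 := by
  have hg := one_sub_pairing_isLittleO hq₁ hq₂ hdot hx₁ hx₂
  have hf : (fun u => u + q₂ 0 * q₁ u - q₁ 0 * q₂ u - (x₁ 0 * a₂ - x₂ 0 * a₁) / 6 * u ^ 3)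
      =o[𝓝 0] fun u => u ^ 3 := by
    refine isLittleO_pow_succ_of_hasDerivAt (n := 2) (fun u => ?_) (by ring) hg
    refine HasDerivAt.congr_deriv ((((hasDerivAt_id u).add ((hq₁ u).const_mul (q₂ 0))).sub
      ((hq₂ u).const_mul (q₁ 0))).sub
      ((hasDerivAt_pow 3 u).const_mul ((x₁ 0 * a₂ - x₂ 0 * a₁) / 6))) ?_
    push_cast
    ring
  have hug : (fun u => u / 2 * (1 - (q₁ 0 * x₁ u + q₂ 0 * x₂ u)
      - (x₁ 0 * a₂ - x₂ 0 * a₁) / 2 * u ^ 2)) =o[𝓝 0] fun u => u ^ 3 := by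
    have hu : (fun u : ℝ => u / 2) =O[𝓝 0] fun u => u := by
      simpa [div_eq_inv_mul] using isBigO_const_mul_self (2⁻¹ : ℝ) (fun u : ℝ => u) (𝓝 0)
    exact (hu.mul_isLittleO hg).congr_right fun u => by ring
  refine (hug.sub hf).congr_left fun u => ?_
  ring

/-- The curvature coefficient is nonnegative when the pairing is maximal at `0`. -/
theorem curvature_nonneg
    (hq₁ : ∀ u, HasDerivAt q₁ (-x₂ u) u) (hq₂ : ∀ u, HasDerivAt q₂ (x₁ u) u)
    (hdot : ∀ u, x₁ u * q₁ u + x₂ u * q₂ u = 1)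
    (hle : ∀ u, q₁ 0 * x₁ u + q₂ 0 * x₂ u ≤ 1)
    (hx₁ : HasDerivAt x₁ a₁ 0) (hx₂ : HasDerivAt x₂ a₂ 0) :
    0 ≤ x₁ 0 * a₂ - x₂ 0 * a₁ := by
  by_contra! hneg
  have hg := one_sub_pairing_isLittleO hq₁ hq₂ hdot hx₁ hx₂
  have hev := isLittleO_iff.1 hg (c := -(x₁ 0 * a₂ - x₂ 0 * a₁) / 4) (by linarith)
  obtain ⟨u, hu, hu0⟩ := ((hev.filter_mono nhdsWithin_le_nhds).and
    (self_mem_nhdsWithin : {(0 : ℝ)}ᶜ ∈ 𝓝[≠] (0 : ℝ))).exists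
  have hpos : 0 < u ^ 2 := by have : u ≠ 0 := hu0; positivity
  rw [Real.norm_eq_abs, Real.norm_of_nonneg hpos.le] at hu
  have h1 := (le_abs_self _).trans hu
  nlinarith [hle u, mul_pos (neg_pos.2 hneg) hpos]

/-- A tangent vector to a curve in duality with `q` vanishes as soon as the curvature
coefficient does. -/
theorem deriv_eq_zero_of_curvature_eq_zero
    (hq₁ : ∀ u, HasDerivAt q₁ (-x₂ u) u) (hq₂ : ∀ u, HasDerivAt q₂ (x₁ u) u)
    (hdot : ∀ u, x₁ u * q₁ u + x₂ u * q₂ u = 1)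
    (hx₁ : HasDerivAt x₁ a₁ 0) (hx₂ : HasDerivAt x₂ a₂ 0)
    (hA : x₁ 0 * a₂ - x₂ 0 * a₁ = 0) : a₁ = 0 ∧ a₂ = 0 := by
  have hd := (hx₁.mul (hq₁ 0)).add (hx₂.mul (hq₂ 0))
  have hconst : x₁ * q₁ + x₂ * q₂ = fun _ => (1 : ℝ) := funext hdot
  rw [hconst] at hd
  have h0 := hd.unique (hasDerivAt_const 0 1)
  constructor
  · linear_combination x₁ 0 * h0 - q₂ 0 * hA - a₁ * hdot 0
  · linear_combination x₂ 0 * h0 + q₁ 0 * hA - a₂ * hdot 0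

end Expansion

section Norm

variable {nrm : ℝ × ℝ → ℝ}

theorem IsNorm2.nonneg (h : IsNorm2 nrm) (x : ℝ × ℝ) : 0 ≤ nrm x := by
  have h1 := h.triangle x ((-1 : ℝ) • x)
  rw [h.smul_eq, neg_one_smul, add_neg_cancel, (h.eq_zero_iff 0).2 rfl] at h1
  norm_num at h1
  exact h1

/-- Elements of the polar of the unit ball are bounded by the norm. -/
theorem IsNorm2.dot2_le (h : IsNorm2 nrm) {q : ℝ × ℝ} (hq : q ∈ polar2 (unitBall2 nrm))
    (x : ℝ × ℝ) : dot2 q x ≤ nrm x := by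
  rcases eq_or_ne x 0 with rfl | hx
  · simp [dot2, h.nonneg]
  have hpos : 0 < nrm x := (h.nonneg x).lt_of_ne fun h0 => hx ((h.eq_zero_iff x).1 h0.symm)
  have hmem : (nrm x)⁻¹ • x ∈ unitBall2 nrm := by
    simp [unitBall2, h.smul_eq, abs_of_pos hpos, hpos.ne']
  have h1 := hq _ hmem
  have h2 : dot2 q ((nrm x)⁻¹ • x) = dot2 q x / nrm x := by
    simp only [dot2, Prod.smul_fst, Prod.smul_snd, smul_eq_mul]
    ring
  rw [h2, div_le_one hpos] at h1
  exact h1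

theorem isClosed_polar2 (K : Set (ℝ × ℝ)) : IsClosed (polar2 K) := by
  simp only [polar2, Set.ofPred_forall]
  refine isClosed_biInter fun x _ => isClosed_le ?_ continuous_const
  unfold dot2
  fun_prop

theorem nrm_le_one_of_mem_frontier (hd : DifferentiableOn ℝ nrm {x | x ≠ 0}) {x : ℝ × ℝ}
    (hx : x ∈ frontier (unitBall2 nrm)) (hx0 : x ≠ 0) : nrm x ≤ 1 := by
  have hc : ContinuousAt nrm x :=
    (hd.differentiableAt (isOpen_ne.mem_nhds hx0)).continuousAt
  have := hc.continuousWithinAt.mem_closure_image (s := unitBall2 nrm) hx.1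
  refine closure_minimal ?_ isClosed_Iic this
  rintro _ ⟨y, hy, rfl⟩
  exact hy

/-- A dual vector exposing `x` is the derivative of the norm at `x`. -/
theorem IsNorm2.fderiv_apply_eq_dot2 (h : IsNorm2 nrm)
    (hd : DifferentiableOn ℝ nrm {x | x ≠ 0}) {q x : ℝ × ℝ}
    (hq : q ∈ polar2 (unitBall2 nrm)) (hx : nrm x ≤ 1) (hqx : dot2 q x = 1) (v : ℝ × ℝ) :
    fderiv ℝ nrm x v = dot2 q v := by
  have hx0 : x ≠ 0 := by rintro rfl; simp [dot2] at hqx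
  let L : ℝ × ℝ →L[ℝ] ℝ :=
    q.1 • ContinuousLinearMap.fst ℝ ℝ ℝ + q.2 • ContinuousLinearMap.snd ℝ ℝ ℝ
  have hL (y : ℝ × ℝ) : L y = dot2 q y := by simp [L, dot2]
  have hmin : IsLocalMin (fun y => nrm y - L y) x := by
    refine Eventually.of_forall fun y => ?_
    have := h.dot2_le hq y
    simp only [hL, hqx]
    linarith
  have hder := hmin.hasFDerivAt_eq_zero
    ((hd.differentiableAt (isOpen_ne.mem_nhds hx0)).hasFDerivAt.sub L.hasFDerivAt)
  rw [sub_eq_zero.1 hder, hL]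

/-- If the derivative of the norm is Lipschitz near `X φ`, a curve `X` dual to `Q` can only be
stationary where `Q` is. -/
theorem IsNorm2.hasDerivAt_dual_zero (h : IsNorm2 nrm) (h3 : IsC11Away nrm)
    {X Q : ℝ → ℝ × ℝ} {φ : ℝ} (hQ : ∀ s, Q s ∈ polar2 (unitBall2 nrm))
    (hX : ∀ s, nrm (X s) ≤ 1) (hXQ : ∀ s, dot2 (Q s) (X s) = 1)
    (hX' : HasDerivAt X 0 φ) : HasDerivAt Q 0 φ := by
  have hX0 (s : ℝ) : X s ≠ 0 := by
    intro h0
    have := hXQ s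
    simp [h0, dot2] at this
  obtain ⟨ε, hε, K, hK⟩ := h3.2 (X φ) (hX0 φ)
  have hgrad (s : ℝ) (v : ℝ × ℝ) : fderiv ℝ nrm (X s) v = dot2 (Q s) v :=
    h.fderiv_apply_eq_dot2 h3.1 (hQ s) (hX s) (hXQ s) v
  rw [hasDerivAt_iff_isLittleO] at hX' ⊢
  simp only [smul_zero, sub_zero] at hX' ⊢
  refine IsBigO.trans_isLittleO (IsBigO.of_bound K ?_) hX'
  have hXc : Tendsto X (𝓝 φ) (𝓝 (X φ)) := by
    have : Tendsto (fun s => X s - X φ) (𝓝 φ) (𝓝 0) := by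
      refine hX'.trans_tendsto ?_
      exact tendsto_sub_nhds_zero_iff.2 tendsto_id
    simpa using this.add_const (X φ)
  filter_upwards [hXc (Metric.ball_mem_nhds _ hε)] with s hs
  have hlip := hK.dist_le_mul _ ⟨hs, hX0 s⟩ _ ⟨Metric.mem_ball_self hε, hX0 φ⟩
  rw [dist_eq_norm, dist_eq_norm] at hlip
  have hcoord (v : ℝ × ℝ) (hv : ‖v‖ = 1) :
      ‖dot2 (Q s) v - dot2 (Q φ) v‖ ≤ K * ‖X s - X φ‖ := by
    have := (fderiv ℝ nrm (X s) - fderiv ℝ nrm (X φ)).le_opNorm v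
    rw [sub_apply, hgrad, hgrad, hv, mul_one] at this
    exact this.trans hlip
  have c1 := hcoord (1, 0) (by simp [Prod.norm_def])
  have c2 := hcoord (0, 1) (by simp [Prod.norm_def])
  simp only [dot2, mul_one, mul_zero, add_zero, zero_add] at c1 c2
  exact max_le c1 c2

end Norm

/-- A locally Lipschitz curve reparametrized by a monotone function is differentiable almost
everywhere. -/
theorem LocallyLipschitz.ae_differentiableAt_comp_monotone {P : ℝ → ℝ × ℝ} {C : ℝ → ℝ}
    (hP : LocallyLipschitz P) (hC : Monotone C) :
    ∀ᵐ φ : ℝ ∂volume, DifferentiableAt ℝ (fun s => P (C s)) φ := by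
  refine LocallyBoundedVariationOn.ae_differentiableAt (f := P ∘ C) fun a b _ _ => ?_
  obtain ⟨K, hK⟩ := (hP.locallyLipschitzOn (s := Icc (C a) (C b))).exists_lipschitzOnWith_of_compact
    isCompact_Icc
  refine hK.comp_boundedVariationOn (fun s hs => ⟨hC hs.2.1, hC hs.2.2⟩) ?_
  exact (hC.monotoneOn univ).locallyBoundedVariationOn a b (mem_univ _) (mem_univ _)

/-- Cubic behaviour of `∂z/∂ω` for small times: there are `K̄, ε̄ > 0` such that for
every `ε ∈ (0,ε̄)`, for a.e. angle `φ`, every `r > 0` and `ω ≠ 0`, one has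
`Z(φ,ω,r;t) = (1+O(ε)) k t³` on some interval `[−ρ,ρ]`. -/
theorem dz_domega_cubic_estimate
    (nrm : ℝ × ℝ → ℝ) (h1 : IsNorm2 nrm)
    (h2 : StrictConvexOn ℝ Set.univ fun x => (nrm x) ^ 2)
    (h3 : IsC11Away nrm)
    (P : ℝ → ℝ × ℝ) (hP : IsAreaParam (unitBall2 nrm) P)
    (Q : ℝ → ℝ × ℝ) (hQ : IsAreaParam (polar2 (unitBall2 nrm)) Q)
    (C : ℝ → ℝ) (hCmono : Monotone C)
    (hCorr : ∀ s, dot2 (P (C s)) (Q s) = 1)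
    (hQ' : ∀ s, HasDerivAt Q (-(P (C s)).2, (P (C s)).1) s) :
    ∃ Kbar > (0:ℝ), ∃ εbar > (0:ℝ), ∀ ε ∈ Set.Ioo (0:ℝ) εbar,
      ∀ᵐ φ : ℝ ∂volume, ∀ r > (0:ℝ), ∀ ω : ℝ, ω ≠ 0 →
        ∃ k > (0:ℝ), ∃ ρ > (0:ℝ), ∀ t ∈ Set.Icc (-ρ) ρ,
          |Zfun P Q C φ ω r t - k * t ^ 3| ≤ Kbar * ε * k * |t| ^ 3 := by
  refine ⟨1, one_pos, 1, one_pos, fun ε hε => ?_⟩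
  filter_upwards [hP.lipschitz.ae_differentiableAt_comp_monotone hCmono] with φ hφ r hr ω hω
  have hQmem (s : ℝ) : Q s ∈ polar2 (unitBall2 nrm) :=
    (isClosed_polar2 _).frontier_subset (hQ.mem_frontier s)
  have hX1 (s : ℝ) : nrm (P (C s)) ≤ 1 := by
    refine nrm_le_one_of_mem_frontier h3.1 (hP.mem_frontier _) fun h0 => ?_
    have := hCorr s
    simp [h0, dot2] at this
  have hXQ (s : ℝ) : dot2 (Q s) (P (C s)) = 1 := by
    rw [← hCorr s]; unfold dot2; ring
  have hq₁ (u : ℝ) : HasDerivAt (fun u => (Q (φ + u)).1) (-(P (C (φ + u))).2) u :=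
    ((hQ' (φ + u)).comp_const_add φ u).fst
  have hq₂ (u : ℝ) : HasDerivAt (fun u => (Q (φ + u)).2) ((P (C (φ + u))).1) u :=
    ((hQ' (φ + u)).comp_const_add φ u).snd
  obtain ⟨v, hv⟩ : ∃ v, HasDerivAt (fun s => P (C s)) v φ := ⟨_, hφ.hasDerivAt⟩
  have hv' : HasDerivAt (fun s => P (C s)) v (φ + 0) := by simpa using hv
  have hx₁ : HasDerivAt (fun u => (P (C (φ + u))).1) v.1 0 :=
    (hv'.comp_const_add φ 0).fst
  have hx₂ : HasDerivAt (fun u => (P (C (φ + u))).2) v.2 0 :=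
    (hv'.comp_const_add φ 0).snd
  have hdot (u : ℝ) : (P (C (φ + u))).1 * (Q (φ + u)).1 + (P (C (φ + u))).2 * (Q (φ + u)).2 = 1 :=
    hCorr (φ + u)
  have hA0 := curvature_nonneg hq₁ hq₂ hdot
    (fun u => (h1.dot2_le (hQmem (φ + 0)) _).trans (hX1 (φ + u))) hx₁ hx₂
  have hA_ne : (P (C (φ + 0))).1 * v.2 - (P (C (φ + 0))).2 * v.1 ≠ 0 := by
    intro hA
    obtain ⟨hv1, hv2⟩ := deriv_eq_zero_of_curvature_eq_zero hq₁ hq₂ hdot hx₁ hx₂ hA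
    rw [show v = 0 from Prod.ext hv1 hv2] at hv
    have hQ0 := (h1.hasDerivAt_dual_zero h3 hQmem hX1 hXQ hv).unique (hQ' φ)
    have e1 : (0 : ℝ) = -(P (C φ)).2 := congrArg Prod.fst hQ0
    have e2 : (0 : ℝ) = (P (C φ)).1 := congrArg Prod.snd hQ0
    have := hCorr φ
    simp [dot2, ← e2, neg_eq_zero.1 e1.symm] at this
  have hexp := cubic_expansion_isLittleO hq₁ hq₂ hdot hx₁ hx₂
  simp only [add_zero] at hA0 hA_ne hexp
  set A := (P (C φ)).1 * v.2 - (P (C φ)).2 * v.1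
  have hA : 0 < A := hA0.lt_of_ne' hA_ne
  have hωt : Tendsto (fun t : ℝ => ω * t) (𝓝 0) (𝓝 0) := by
    simpa using (continuous_const_mul ω).tendsto 0
  have hev := isLittleO_iff.1 (hexp.comp_tendsto hωt) (c := ε * A / 12)
    (by have := hε.1; positivity)
  obtain ⟨δ, hδ, hball⟩ := Metric.eventually_nhds_iff_ball.1 hev
  refine ⟨r ^ 2 * A / 12, by positivity, δ / 2, by positivity, fun t ht => ?_⟩
  have hb := hball t (by
    rw [mem_ball_zero_iff, Real.norm_eq_abs]
    linarith [abs_le.2 ht])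
  simp only [Function.comp_apply, Real.norm_eq_abs] at hb
  have hZ : Zfun P Q C φ ω r t - r ^ 2 * A / 12 * t ^ 3 = r ^ 2 / ω ^ 3 *
      (ω * t / 2 * (1 - ((Q φ).1 * (P (C (φ + ω * t))).1 + (Q φ).2 * (P (C (φ + ω * t))).2))
        - (ω * t + (Q φ).2 * (Q (φ + ω * t)).1 - (Q φ).1 * (Q (φ + ω * t)).2)
        - A / 12 * (ω * t) ^ 3) := by
    unfold Zfun dot2
    field_simp
  rw [hZ, abs_mul]
  refine (mul_le_mul_of_nonneg_left hb (abs_nonneg _)).trans_eq ?_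
  rw [abs_div, abs_of_pos (pow_pos hr 2), abs_pow, abs_pow, abs_mul]
  have : |ω| ≠ 0 := abs_ne_zero.2 hω
  field_simp
end

section
/- Let ‖·‖ be a strictly convex C^{1,1} norm on ℝ² with unit ball Ω and dual unit ball Ω°; let P, Q be area parametrizations of ∂Ω, ∂Ω°, and C : ℝ → ℝ the nondecreasing correspondence with ⟨P(C(s)), Q(s)⟩ = 1 for all s; assume Q is differentiable everywhere with Q′(s) = (−P₂(C(s)), P₁(C(s))). Fix r > 0, ω ≠ 0 and φ ∈ ℝ such that C is differentiable at φ with C′(φ) > 0. Define a(t) := (1/ω)(Q₂(φ+ωt) − Q₂(φ)), b(t) := (r/ω)(P₁(C(φ+ωt)) − P₁(C(φ))), c(t) := −(1/ω)(Q₁(φ+ωt) − Q₁(φ)), d(t) := (r/ω)(P₂(C(φ+ωt)) − P₂(C(φ))) (these are ∂x/∂r, ∂x/∂φ, ∂y/∂r, ∂y/∂φ for the Heisenberg exponential map). Then a(t)·d(t) − c(t)·b(t) = r·C′(φ)·t² + o(t²) as t → 0; in particular this determinant is asymptotic to a nonzero multiple of t². -/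
open MeasureTheory

open Asymptotics

/-- A locally Lipschitz plane curve sweeping area at unit rate almost everywhere does so, to first
order, at every parameter. -/
theorem hasDerivAt_cross_of_area {R : ℝ → ℝ × ℝ} (hR : LocallyLipschitz R)
    (harea : ∀ᵐ θ : ℝ ∂volume,
      ∃ v : ℝ × ℝ, HasDerivAt R v θ ∧ (R θ).1 * v.2 - (R θ).2 * v.1 = 1) (θ₀ : ℝ) :
    HasDerivAt (fun θ => (R θ₀).1 * (R θ).2 - (R θ₀).2 * (R θ).1) 1 θ₀ := by
  obtain ⟨K, t, ht, hK⟩ := hR θ₀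
  obtain ⟨ε, hε, hεt⟩ := Metric.mem_nhds_iff.1 ht
  replace hK := hK.mono hεt
  have key : ∀ θ ∈ Metric.ball θ₀ ε,
      ‖(R θ₀).1 * (R θ).2 - (R θ₀).2 * (R θ).1 - (θ - θ₀)‖ ≤ 2 * K ^ 2 * ‖‖θ - θ₀‖ ^ 2‖ := by
    intro θ hθ
    have hsub : Set.uIcc θ₀ θ ⊆ Metric.ball θ₀ ε :=
      (convex_ball θ₀ ε).ordConnected.uIcc_subset (Metric.mem_ball_self hε) hθ
    have hL := hK.mono hsub
    have h₁ := (LipschitzWith.prod_fst.comp_lipschitzOnWith hL).absolutelyContinuousOnInterval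
    have h₂ := (LipschitzWith.prod_snd.comp_lipschitzOnWith hL).absolutelyContinuousOnInterval
    have hid := (LipschitzWith.id.lipschitzOnWith
      (s := Set.uIcc θ₀ θ)).absolutelyContinuousOnInterval
    have hac := ((h₂.const_mul (R θ₀).1).sub (h₁.const_mul (R θ₀).2)).sub hid
    have hint := hac.integral_deriv_eq_sub
    have hbound := intervalIntegral.norm_integral_le_of_norm_le_const_ae
      (a := θ₀) (b := θ) (C := 2 * K ^ 2 * |θ - θ₀|)
      (f := deriv ((fun x => (R θ₀).1 * (R x).2) - (fun x => (R θ₀).2 * (R x).1) - id)) (by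
        filter_upwards [harea] with x hx hxI
        obtain ⟨v, hv, hv1⟩ := hx
        have hxI' := Set.uIoc_subset_uIcc hxI
        have hxb := hsub hxI'
        have hd := (((hasFDerivAt_snd.comp_hasDerivAt x hv).const_mul (R θ₀).1).sub
          ((hasFDerivAt_fst.comp_hasDerivAt x hv).const_mul (R θ₀).2)).sub (hasDerivAt_id x)
        have hvK : ‖v‖ ≤ K := hv.le_of_lipschitzOn (Metric.isOpen_ball.mem_nhds hxb) hK
        have hdist : ‖R x - R θ₀‖ ≤ K * |θ - θ₀| := by
          have := hK.dist_le_mul x hxb θ₀ (Metric.mem_ball_self hε)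
          rw [dist_eq_norm, Real.dist_eq] at this
          exact this.trans (mul_le_mul_of_nonneg_left
            (by simpa [abs_sub_comm] using Set.abs_sub_left_of_mem_uIcc hxI') K.2)
        have hv₁ := (norm_fst_le v).trans hvK
        have hv₂ := (norm_snd_le v).trans hvK
        have hd₁ := (norm_fst_le (R x - R θ₀)).trans hdist
        have hd₂ := (norm_snd_le (R x - R θ₀)).trans hdist
        refine (congrArg norm hd.deriv).trans_le ?_
        calc ‖(R θ₀).1 * v.2 - (R θ₀).2 * v.1 - 1‖
            = ‖(R x - R θ₀).2 * v.1 - (R x - R θ₀).1 * v.2‖ := by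
              rw [← hv1, Prod.fst_sub, Prod.snd_sub]; congr 1; ring
          _ ≤ ‖(R x - R θ₀).2‖ * ‖v.1‖ + ‖(R x - R θ₀).1‖ * ‖v.2‖ := by
              rw [← norm_mul, ← norm_mul]; exact norm_sub_le _ _
          _ ≤ K * |θ - θ₀| * K + K * |θ - θ₀| * K := by gcongr
          _ = 2 * K ^ 2 * |θ - θ₀| := by ring)
    have heq : ∫ x in θ₀..θ,
        deriv ((fun x => (R θ₀).1 * (R x).2) - (fun x => (R θ₀).2 * (R x).1) - id) x =
        (R θ₀).1 * (R θ).2 - (R θ₀).2 * (R θ).1 - (θ - θ₀) := by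
      refine hint.trans ?_
      simp only [Pi.sub_apply, Function.comp_apply, id]
      ring
    rw [heq] at hbound
    refine hbound.trans_eq ?_
    rw [norm_pow, norm_norm, Real.norm_eq_abs]
    ring
  rw [hasDerivAt_iff_isLittleO]
  have hO : (fun θ => (R θ₀).1 * (R θ).2 - (R θ₀).2 * (R θ).1 - (θ - θ₀))
      =O[nhds θ₀] fun θ => ‖θ - θ₀‖ ^ 2 :=
    IsBigO.of_bound _ (Filter.eventually_of_mem (Metric.ball_mem_nhds θ₀ hε) key)
  refine (hO.trans_isLittleO (isLittleO_pow_sub_sub θ₀ one_lt_two)).congr_left fun θ => ?_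
  rw [smul_eq_mul]
  ring

/-- The quadratic expansion of the determinant
`(∂x/∂r)(∂y/∂φ) − (∂y/∂r)(∂x/∂φ) = r C′(φ) t² + o(t²)` for the exponential map of the
sub-Finsler Heisenberg group; in particular it is asymptotic to a nonzero multiple
of `t²`. -/
theorem detM1_quadratic_asymptotics
    (nrm : ℝ × ℝ → ℝ) (h1 : IsNorm2 nrm)
    (h2 : StrictConvexOn ℝ Set.univ fun x => (nrm x) ^ 2)
    (h3 : IsC11Away nrm)
    (P : ℝ → ℝ × ℝ) (hP : IsAreaParam (unitBall2 nrm) P)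
    (Q : ℝ → ℝ × ℝ) (hQ : IsAreaParam (polar2 (unitBall2 nrm)) Q)
    (C : ℝ → ℝ) (hCmono : Monotone C)
    (hCorr : ∀ s, dot2 (P (C s)) (Q s) = 1)
    (hQ' : ∀ s, HasDerivAt Q (-(P (C s)).2, (P (C s)).1) s)
    (φ ω r : ℝ) (hr : 0 < r) (hω : ω ≠ 0)
    (c' : ℝ) (hC' : HasDerivAt C c' φ) (hc' : 0 < c') :
    (fun t =>
        ((1 / ω) * ((Q (φ + ω * t)).2 - (Q φ).2)) *
            ((r / ω) * ((P (C (φ + ω * t))).2 - (P (C φ)).2)) -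
          (-(1 / ω) * ((Q (φ + ω * t)).1 - (Q φ).1)) *
            ((r / ω) * ((P (C (φ + ω * t))).1 - (P (C φ)).1)) -
          r * c' * t ^ 2)
      =o[nhds (0:ℝ)] fun t => t ^ 2 := by
  have hf := (hasDerivAt_cross_of_area hP.lipschitz hP.area (C φ)).comp φ hC'
  rw [one_mul] at hf
  have hPC : (fun s => P (C s) - P (C φ)) =O[nhds φ] fun s => s - φ := by
    obtain ⟨K, t, ht, hK⟩ := hP.lipschitz (C φ)
    refine IsBigO.trans (IsBigO.of_bound K ?_) hC'.isBigO_sub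
    filter_upwards [hC'.continuousAt ht] with s hs
    exact hK.norm_sub_le hs (mem_of_mem_nhds ht)
  have hQo := hasDerivAt_iff_isLittleO.1 (hQ' φ)
  have hfo := hasDerivAt_iff_isLittleO.1 hf
  have hQ₁ := isBigO_fst_prod'.trans_isLittleO hQo
  have hQ₂ := isBigO_snd_prod'.trans_isLittleO hQo
  have hsum := ((hQ₁.mul_isBigO (isBigO_fst_prod'.trans hPC)).add
    (hQ₂.mul_isBigO (isBigO_snd_prod'.trans hPC))).add
    ((isBigO_refl (fun s : ℝ => s - φ) (nhds φ)).mul_isLittleO hfo)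
  have htend : Filter.Tendsto (fun t => φ + ω * t) (nhds 0) (nhds φ) := by
    have : Continuous fun t => φ + ω * t := by fun_prop
    simpa using this.tendsto 0
  have hcomp := (hsum.comp_tendsto htend).const_mul_left (r / ω ^ 2)
  have hsq : ((fun s => (s - φ) * (s - φ)) ∘ fun t => φ + ω * t)
      =O[nhds (0:ℝ)] fun t => t ^ 2 := by
    refine ((isBigO_refl (fun t : ℝ => t ^ 2) (nhds 0)).const_mul_left (ω ^ 2)).congr_left
      fun t => ?_
    simp only [Function.comp_apply]
    ring
  refine (hcomp.trans_isBigO hsq).congr_left fun t => ?_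
  simp only [Function.comp_apply, Prod.fst_sub, Prod.snd_sub, Prod.smul_fst, Prod.smul_snd,
    smul_eq_mul]
  field_simp
  ring
end

section
/- Let ‖·‖ be a strictly convex C^{1,1} norm on ℝ² with unit ball Ω and dual unit ball Ω°; let P, Q be area parametrizations of ∂Ω, ∂Ω°, and C : ℝ → ℝ the nondecreasing correspondence with ⟨P(C(s)), Q(s)⟩ = 1 for all s; assume Q is differentiable everywhere with Q′(s) = (−P₂(C(s)), P₁(C(s))). Fix ω ≠ 0 and φ ∈ ℝ such that C is differentiable at φ and P is differentiable at C(φ) with P′(C(φ)) = (−Q₂(φ), Q₁(φ)). Then ωt + Q₁(φ+ωt)·Q₂(φ) − Q₂(φ+ωt)·Q₁(φ) = o(t²) as t → 0 (equivalently, the partial derivative ∂z/∂r = (r/ω²)(ωt + Q₁(φ+ωt)Q₂(φ) − Q₂(φ+ωt)Q₁(φ)) of the vertical component of the Heisenberg exponential map is o(t²)). -/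
open MeasureTheory

open Asymptotics

/-- Pairing a differentiable curve with a fixed vector commutes with differentiation. -/
theorem HasDerivAt.dot2_const {f : ℝ → ℝ × ℝ} {f' : ℝ × ℝ} {u : ℝ} (hf : HasDerivAt f f' u)
    (q : ℝ × ℝ) : HasDerivAt (fun v => dot2 (f v) q) (dot2 f' q) u := by
  have hfst : HasDerivAt (fun v => (f v).1) f'.1 u := by
    simpa using (hf.hasFDerivAt.fst).hasDerivAt
  have hsnd : HasDerivAt (fun v => (f v).2) f'.2 u := by
    simpa using (hf.hasFDerivAt.snd).hasDerivAt
  exact (hfst.mul_const q.1).add (hsnd.mul_const q.2)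

/-- If `g 0 = 0` and the derivative of `g` is `o(u)` at the origin, then `g` is `o(u ^ 2)`. -/
theorem isLittleO_sq_of_hasDerivAt_isLittleO_id {g g' : ℝ → ℝ} (h0 : g 0 = 0)
    (hg : ∀ u, HasDerivAt g (g' u) u) (hg' : g' =o[nhds 0] fun u => u) :
    g =o[nhds 0] fun u => u ^ 2 := by
  rw [isLittleO_iff] at hg' ⊢
  intro c hc
  obtain ⟨δ, hδ, hball⟩ := Metric.eventually_nhds_iff.1 (hg' hc)
  refine Metric.eventually_nhds_iff.2 ⟨δ, hδ, fun u hu => ?_⟩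
  rw [dist_zero_right] at hu
  have hbound : ∀ v ∈ Metric.closedBall (0 : ℝ) ‖u‖, ‖g' v‖ ≤ c * ‖u‖ := by
    intro v hv
    rw [mem_closedBall_zero_iff] at hv
    calc ‖g' v‖ ≤ c * ‖v‖ := hball (by rw [dist_zero_right]; exact hv.trans_lt hu)
      _ ≤ c * ‖u‖ := by gcongr
  have := (convex_closedBall (0 : ℝ) ‖u‖).norm_image_sub_le_of_norm_hasDerivWithin_le
    (fun v _ => (hg v).hasDerivWithinAt) hbound (x := 0) (y := u) (by simp) (by simp)
  rw [h0, sub_zero, sub_zero] at this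
  calc ‖g u‖ ≤ c * ‖u‖ * ‖u‖ := this
    _ = c * ‖u ^ 2‖ := by rw [norm_pow]; ring

/-- The quantity `ωt + Q₁(φ+ωt)Q₂(φ) − Q₂(φ+ωt)Q₁(φ)` is `o(t²)` as `t → 0`;
equivalently, the partial derivative `∂z/∂r` of the vertical component of the
Heisenberg exponential map is `o(t²)`. -/
theorem dz_dr_is_little_o
    (nrm : ℝ × ℝ → ℝ) (h1 : IsNorm2 nrm)
    (h2 : StrictConvexOn ℝ Set.univ fun x => (nrm x) ^ 2)
    (h3 : IsC11Away nrm)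
    (P : ℝ → ℝ × ℝ) (hP : IsAreaParam (unitBall2 nrm) P)
    (Q : ℝ → ℝ × ℝ) (hQ : IsAreaParam (polar2 (unitBall2 nrm)) Q)
    (C : ℝ → ℝ) (hCmono : Monotone C)
    (hCorr : ∀ s, dot2 (P (C s)) (Q s) = 1)
    (hQ' : ∀ s, HasDerivAt Q (-(P (C s)).2, (P (C s)).1) s)
    (φ ω : ℝ) (hω : ω ≠ 0)
    (hCdiff : ∃ c' : ℝ, HasDerivAt C c' φ)
    (hP' : HasDerivAt P (-(Q φ).2, (Q φ).1) (C φ)) :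
    (fun t => ω * t + (Q (φ + ω * t)).1 * (Q φ).2 - (Q (φ + ω * t)).2 * (Q φ).1)
      =o[nhds (0:ℝ)] fun t => t ^ 2 := by
  obtain ⟨c', hc'⟩ := hCdiff
  have hC0 : HasDerivAt (fun u => P (C (φ + u))) (c' • (-(Q φ).2, (Q φ).1)) 0 := by
    have hPC := HasDerivAt.scomp φ hP' hc'
    exact HasDerivAt.comp_const_add φ 0 (by rwa [add_zero])
  have hdefect : (fun u => 1 - dot2 (P (C (φ + u))) (Q φ)) =o[nhds 0] fun u : ℝ => u := by
    have horth : dot2 (c' • (-(Q φ).2, (Q φ).1)) (Q φ) = 0 := by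
      simp only [dot2, Prod.smul_fst, Prod.smul_snd, smul_eq_mul]
      ring
    have h := (hC0.dot2_const (Q φ)).isLittleO
    rw [horth] at h
    simpa [hCorr φ] using h.neg_left
  have hderiv : ∀ u, HasDerivAt
      (fun u => u + (Q (φ + u)).1 * (Q φ).2 - (Q (φ + u)).2 * (Q φ).1)
      (1 - dot2 (P (C (φ + u))) (Q φ)) u := by
    intro u
    have hQu := ((hQ' (φ + u)).comp_const_add φ u).dot2_const ((Q φ).2, -(Q φ).1)
    refine (((hasDerivAt_id u).add hQu).congr_deriv ?_).congr_of_eventuallyEq (.of_forall ?_)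
    · simp only [dot2]
      ring
    · intro v
      simp only [dot2, Pi.add_apply, id]
      ring
  have hsq := isLittleO_sq_of_hasDerivAt_isLittleO_id (by simp; ring) hderiv hdefect
  have hlim : Filter.Tendsto (fun t : ℝ => ω * t) (nhds 0) (nhds 0) := by
    simpa using (continuous_const_mul ω).tendsto 0
  refine (hsq.comp_tendsto hlim).trans_isBigO ?_
  refine ((isBigO_refl (fun t : ℝ => t ^ 2) (nhds 0)).const_mul_left (ω ^ 2)).congr_left ?_
  intro t
  simp only [Function.comp_apply]
  ring
end

section
/- Let Ω ⊂ ℝ² be a compact convex set with 0 in its interior and let P = (P₁,P₂) be an area parametrization of ∂Ω. Then for almost every θ ∈ ℝ there exists a unique q = (q₁,q₂) ∈ ℝ² such that ⟨q, P(θ)⟩ = 1, ⟨q, x⟩ ≤ 1 for every x ∈ Ω (so q lies in the polar set Ω°, in fact on its boundary), and P′(θ) = (−q₂, q₁). In the paper's notation: sin_Ω′(θ) = cos_{Ω°}(ψ) and cos_Ω′(θ) = −sin_{Ω°}(ψ), where ψ is the unique angle corresponding to θ. -/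
open MeasureTheory

/-- A convex set with `0` in its interior has a supporting linear functional at each frontier point,
positive at that point. -/
theorem exists_supporting_functional {K : Set (ℝ × ℝ)} (hK : Convex ℝ K)
    (h0 : (0 : ℝ × ℝ) ∈ interior K) {p : ℝ × ℝ} (hp : p ∈ frontier K) :
    ∃ f : ℝ × ℝ →L[ℝ] ℝ, 0 < f p ∧ ∀ x ∈ closure K, f x ≤ f p := by
  obtain ⟨f, hf⟩ := geometric_hahn_banach_open_point hK.interior isOpen_interior hp.2
  refine ⟨f, by simpa using hf 0 h0, fun x hx => ?_⟩
  rw [← hK.closure_interior_eq_closure_of_nonempty_interior ⟨0, h0⟩] at hx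
  exact closure_minimal (fun y hy => (hf y hy).le) (isClosed_le f.continuous continuous_const) hx

/-- A continuous linear functional on `ℝ × ℝ` in coordinates. -/
theorem clm_apply_eq_coords (f : ℝ × ℝ →L[ℝ] ℝ) (x : ℝ × ℝ) :
    f x = f (1, 0) * x.1 + f (0, 1) * x.2 := by
  have hx : x = x.1 • ((1, 0) : ℝ × ℝ) + x.2 • ((0, 1) : ℝ × ℝ) := by ext <;> simp
  conv_lhs => rw [hx]
  rw [map_add, map_smul, map_smul, smul_eq_mul, smul_eq_mul]
  ring

/-- Differentiation of the convex trigonometric functions: for a.e. `θ` there is a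
unique `q` lying in the polar `Ω°` with `⟨q, P θ⟩ = 1` (i.e. `q = Q_ψ` for the unique
corresponding angle `ψ`) such that `P′(θ) = (−q₂, q₁)`; in the paper's notation,
`sin_Ω′(θ) = cos_{Ω°}(ψ)` and `cos_Ω′(θ) = −sin_{Ω°}(ψ)`. -/
theorem areaParam_deriv_ae
    (Ω : Set (ℝ × ℝ)) (hΩc : IsCompact Ω) (hΩconv : Convex ℝ Ω)
    (hΩ0 : ((0, 0) : ℝ × ℝ) ∈ interior Ω)
    (P : ℝ → ℝ × ℝ) (hP : IsAreaParam Ω P) :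
    ∀ᵐ θ : ℝ ∂volume, ∃! q : ℝ × ℝ,
      dot2 q (P θ) = 1 ∧ (∀ x ∈ Ω, dot2 q x ≤ 1) ∧
        HasDerivAt P (-q.2, q.1) θ := by
  filter_upwards [hP.area] with θ ⟨v, hv, harea⟩
  refine ⟨(v.2, -v.1), ⟨by simp only [dot2]; linarith, ?_, by simpa using hv⟩, ?_⟩
  · obtain ⟨f, hpos, hmax⟩ := exists_supporting_functional hΩconv hΩ0 (hP.mem_frontier θ)
    have hloc : IsLocalMax (fun t => f (P t)) θ :=
      Filter.Eventually.of_forall fun t => hmax _ (frontier_subset_closure (hP.mem_frontier t))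
    have hfv : f v = 0 := hloc.hasDerivAt_eq_zero (f.hasFDerivAt.comp_hasDerivAt θ hv)
    have hfP := clm_apply_eq_coords f (P θ)
    rw [clm_apply_eq_coords] at hfv
    have ha : f (1, 0) = v.2 * f (P θ) := by
      linear_combination (-f (1, 0)) * harea - v.2 * hfP - (P θ).2 * hfv
    have hb : f (0, 1) = -v.1 * f (P θ) := by
      linear_combination (-f (0, 1)) * harea + v.1 * hfP + (P θ).1 * hfv
    intro x hx
    have hle := hmax x (subset_closure hx)
    rw [clm_apply_eq_coords f x, ha, hb] at hle
    simp only [dot2]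
    exact le_of_mul_le_mul_right (by linarith) hpos
  · rintro q ⟨-, -, hq⟩
    have h := hq.unique hv
    ext
    · simp [← h]
    · simp [← h]
end

section
/- Let Ω ⊂ ℝ² be a compact convex set with 0 in its interior and let P = (P₁,P₂) be an area parametrization of ∂Ω. If I ⊂ ℝ is an interval on which P₂ ≥ 0, then P₂ is concave on I; if P₂ ≤ 0 on I, then P₂ is convex on I; and the same holds for P₁. In the paper's notation: the convex trigonometric functions sin_Ω and cos_Ω are concave on every interval where they are non-negative and convex on every interval where they are non-positive. -/
open MeasureTheory

open Set

theorem LocallyLipschitz.absolutelyContinuousOnInterval {f : ℝ → ℝ} (hf : LocallyLipschitz f)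
    (a b : ℝ) : AbsolutelyContinuousOnInterval f a b := by
  obtain ⟨K, hK⟩ := LocallyLipschitzOn.exists_lipschitzOnWith_of_compact
    (isCompact_uIcc (a := a) (b := b)) hf.locallyLipschitzOn
  exact hK.absolutelyContinuousOnInterval

/-- A mean value inequality for locally Lipschitz functions whose derivative is bounded below
almost everywhere. -/
theorem LocallyLipschitz.mul_sub_le_sub_of_ae_hasDerivAt {f : ℝ → ℝ} (hf : LocallyLipschitz f)
    {a b c : ℝ} (hab : a ≤ b)
    (hc : ∀ᵐ s : ℝ, s ∈ Ioo a b → ∃ d, HasDerivAt f d s ∧ c ≤ d) :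
    c * (b - a) ≤ f b - f a := by
  have hac := hf.absolutelyContinuousOnInterval a b
  rw [← hac.integral_deriv_eq_sub]
  have hconst : c * (b - a) = ∫ _ in a..b, c := by
    rw [intervalIntegral.integral_const, smul_eq_mul, mul_comm]
  rw [hconst]
  refine intervalIntegral.integral_mono_ae_restrict hab intervalIntegrable_const
    hac.intervalIntegrable_deriv ?_
  rw [← Measure.restrict_congr_set Ioo_ae_eq_Icc]
  refine (ae_restrict_iff' measurableSet_Ioo).2 ?_
  filter_upwards [hc] with s hs hsab
  obtain ⟨d, hd, hcd⟩ := hs hsab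
  exact hcd.trans_eq hd.deriv.symm

namespace IsAreaParam

/-- A time at which the sector area identity holds with velocity `v`. -/
def IsRegular (R : ℝ → ℝ × ℝ) (θ : ℝ) (v : ℝ × ℝ) : Prop :=
  HasDerivAt R v θ ∧ (R θ).1 * v.2 - (R θ).2 * v.1 = 1

variable {K : Set (ℝ × ℝ)} {R : ℝ → ℝ × ℝ}

theorem locallyLipschitz_linear (hR : IsAreaParam K R) (a b : ℝ) :
    LocallyLipschitz fun θ => a * (R θ).1 + b * (R θ).2 := by
  have hlin : LocallyLipschitz fun p : ℝ × ℝ => a * p.1 + b * p.2 :=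
    ContDiff.locallyLipschitz (𝕂 := ℝ) (by fun_prop)
  exact hlin.comp hR.lipschitz

theorem IsRegular.hasDerivAt_linear {θ : ℝ} {v : ℝ × ℝ} (h : IsRegular R θ v) (a b : ℝ) :
    HasDerivAt (fun θ => a * (R θ).1 + b * (R θ).2) (a * v.1 + b * v.2) θ :=
  by
  have h1 : HasDerivAt (fun θ => (R θ).1) v.1 θ := by simpa using h.1.hasFDerivAt.fst.hasDerivAt
  have h2 : HasDerivAt (fun θ => (R θ).2) v.2 θ := by simpa using h.1.hasFDerivAt.snd.hasDerivAt
  exact (h1.const_mul a).add (h2.const_mul b)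

/-- The rotated velocity of an area parametrization lies in the polar set. -/
theorem cross_velocity_le_one (hR : IsAreaParam K R) (hc : IsCompact K) (hconv : Convex ℝ K)
    (h0 : ((0, 0) : ℝ × ℝ) ∈ interior K) {θ : ℝ} {v : ℝ × ℝ} (hv : IsRegular R θ v)
    {x : ℝ × ℝ} (hx : x ∈ K) : x.1 * v.2 - x.2 * v.1 ≤ 1 := by
  obtain ⟨f, hf0, hf⟩ := geometric_hahn_banach_of_nonempty_interior_point hconv
    (hR.mem_frontier θ).2 ⟨_, h0⟩
  set a := f (1, 0) with ha
  set b := f (0, 1) with hb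
  have hfab : ∀ p, f p = a * p.1 + b * p.2 := fun p => by
    have hp : p = p.1 • ((1, 0) : ℝ × ℝ) + p.2 • ((0, 1) : ℝ × ℝ) := by ext <;> simp
    conv_lhs => rw [hp]
    rw [map_add, map_smul, map_smul, smul_eq_mul, smul_eq_mul, ha, hb]
    ring
  simp only [hfab] at hf
  have hmax : IsLocalMax (fun θ => a * (R θ).1 + b * (R θ).2) θ :=
    Filter.Eventually.of_forall fun s => hf _ (hc.isClosed.frontier_subset (hR.mem_frontier s))
  have hperp := hmax.hasDerivAt_eq_zero (hv.hasDerivAt_linear a b)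
  have hdet := hv.2
  set l := a * (R θ).1 + b * (R θ).2 with hl
  have hal : a = l * v.2 := by
    linear_combination (-a) * hdet - (R θ).2 * hperp + v.2 * hl
  have hbl : b = -(l * v.1) := by
    linear_combination (-b) * hdet + (R θ).1 * hperp - v.1 * hl
  have hl0 : 0 ≤ l := by simpa using hf _ (interior_subset h0)
  have hlpos : 0 < l := by
    refine hl0.lt_of_ne fun h => hf0 ?_
    rw [← h] at hal hbl
    ext <;> simp [hfab, hal, hbl]
  have hxl := hf x hx
  rw [hal, hbl] at hxl
  refine le_of_mul_le_mul_left ?_ hlpos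
  linarith

/-- Uniform positivity of the cross product at short distance. -/
theorem exists_pos_cross (hR : IsAreaParam K R) (hc : IsCompact K) (hconv : Convex ℝ K)
    (h0 : ((0, 0) : ℝ × ℝ) ∈ interior K) :
    ∃ δ > 0, ∀ θ τ, θ < τ → τ - θ < δ → 0 < (R θ).1 * (R τ).2 - (R θ).2 * (R τ).1 := by
  have hae : ∀ᵐ s : ℝ, ∃ v, IsRegular R s v := hR.area
  obtain ⟨r, hr, hball⟩ := Metric.mem_nhds_iff.1 (mem_interior_iff_mem_nhds.1 h0)
  obtain ⟨L, hL, hvL⟩ : ∃ L > 0, ∀ s v, IsRegular R s v → |v.1| ≤ L ∧ |v.2| ≤ L := by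
    have hmem : ∀ x y : ℝ, |x| < r → |y| < r → (x, y) ∈ K := fun x y hx hy => hball <| by
      simp [Prod.dist_eq, hx, hy]
    have hr2 : |r / 2| < r := by rw [abs_of_pos (by positivity)]; linarith
    have hr2' : |-(r / 2)| < r := by rwa [abs_neg]
    have hz : |(0 : ℝ)| < r := by simpa
    refine ⟨2 / r, by positivity, fun s v hv => ?_⟩
    have key := fun x y hx hy => hR.cross_velocity_le_one hc hconv h0 hv (hmem x y hx hy)
    have h1 := key _ _ hr2 hz
    have h2 := key _ _ hr2' hz
    have h3 := key _ _ hz hr2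
    have h4 := key _ _ hz hr2'
    simp only at h1 h2 h3 h4
    constructor <;> rw [le_div_iff₀ hr, ← abs_of_pos hr, ← abs_mul, abs_le] <;>
      constructor <;> linarith
  have hgrow : ∀ a b, |a| ≤ 1 → |b| ≤ 1 → ∀ θ τ, θ ≤ τ →
      -(2 * L) * (τ - θ) ≤
        (a * (R τ).1 + b * (R τ).2) - (a * (R θ).1 + b * (R θ).2) := by
    intro a b ha hb θ τ hθτ
    refine (hR.locallyLipschitz_linear a b).mul_sub_le_sub_of_ae_hasDerivAt hθτ ?_
    filter_upwards [hae] with s ⟨v, hv⟩ _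
    refine ⟨_, hv.hasDerivAt_linear a b, ?_⟩
    have h1 : |a * v.1| ≤ 1 * L := by
      rw [abs_mul]; exact mul_le_mul ha (hvL s v hv).1 (abs_nonneg _) zero_le_one
    have h2 : |b * v.2| ≤ 1 * L := by
      rw [abs_mul]; exact mul_le_mul hb (hvL s v hv).2 (abs_nonneg _) zero_le_one
    linarith [neg_abs_le (a * v.1), neg_abs_le (b * v.2)]
  have hlip : ∀ θ τ, θ ≤ τ →
      |(R τ).1 - (R θ).1| ≤ 2 * L * (τ - θ) ∧ |(R τ).2 - (R θ).2| ≤ 2 * L * (τ - θ) := by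
    intro θ τ h
    have h1 := hgrow 1 0 (by simp) (by simp) θ τ h
    have h2 := hgrow (-1) 0 (by simp) (by simp) θ τ h
    have h3 := hgrow 0 1 (by simp) (by simp) θ τ h
    have h4 := hgrow 0 (-1) (by simp) (by simp) θ τ h
    constructor <;> rw [abs_le] <;> constructor <;> linarith
  refine ⟨1 / (8 * L ^ 2), by positivity, fun θ τ hθτ hδ => ?_⟩
  have hD := (hR.locallyLipschitz_linear (-(R θ).2) (R θ).1).mul_sub_le_sub_of_ae_hasDerivAt
    (c := 1 / 2) hθτ.le <| by
      filter_upwards [hae] with s ⟨v, hv⟩ hs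
      refine ⟨_, hv.hasDerivAt_linear _ _, ?_⟩
      obtain ⟨h1, h2⟩ := hlip θ s hs.1.le
      obtain ⟨hv1, hv2⟩ := hvL s v hv
      have hpos : 0 ≤ 2 * L * (s - θ) := (abs_nonneg _).trans h1
      have h3 : |((R s).1 - (R θ).1) * v.2| ≤ 2 * L * (s - θ) * L := by
        rw [abs_mul]; exact mul_le_mul h1 hv2 (abs_nonneg _) hpos
      have h4 : |((R s).2 - (R θ).2) * v.1| ≤ 2 * L * (s - θ) * L := by
        rw [abs_mul]; exact mul_le_mul h2 hv1 (abs_nonneg _) hpos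
      have h5 : (s - θ) * (8 * L ^ 2) ≤ 1 := by
        rw [← le_div_iff₀ (by positivity)]
        linarith [hs.2]
      linarith [hv.2, le_abs_self (((R s).1 - (R θ).1) * v.2),
        neg_abs_le (((R s).2 - (R θ).2) * v.1)]
  linarith

/-- The cone comparison of velocities at two nearby times. -/
theorem linear_velocity_le_of_cross_pos (hR : IsAreaParam K R) (hc : IsCompact K)
    (hconv : Convex ℝ K) (h0 : ((0, 0) : ℝ × ℝ) ∈ interior K) {θ τ : ℝ} {v w : ℝ × ℝ}
    (hv : IsRegular R θ v) (hw : IsRegular R τ w)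
    (hD : 0 < (R θ).1 * (R τ).2 - (R θ).2 * (R τ).1) {a b : ℝ}
    (hθ : 0 ≤ a * (R θ).1 + b * (R θ).2) (hτ : 0 ≤ a * (R τ).1 + b * (R τ).2) :
    a * w.1 + b * w.2 ≤ a * v.1 + b * v.2 := by
  have hK := fun s => hc.isClosed.frontier_subset (hR.mem_frontier s)
  have h1 := hR.cross_velocity_le_one hc hconv h0 hv (hK τ)
  have h2 := hR.cross_velocity_le_one hc hconv h0 hw (hK θ)
  have h3 := hv.2
  have h4 := hw.2
  refine le_of_mul_le_mul_left ?_ hD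
  have e1 : 0 ≤ (a * (R θ).1 + b * (R θ).2) * (1 - ((R τ).1 * v.2 - (R τ).2 * v.1)) :=
    mul_nonneg hθ (by linarith)
  have e2 : 0 ≤ (a * (R τ).1 + b * (R τ).2) * (1 - ((R θ).1 * w.2 - (R θ).2 * w.1)) :=
    mul_nonneg hτ (by linarith)
  linear_combination e1 + e2 - (a * (R θ).1 + b * (R θ).2) * h4
    - (a * (R τ).1 + b * (R τ).2) * h3

theorem exists_isRegular_mem_Ioo (hR : IsAreaParam K R) {x y : ℝ} (hxy : x < y) :
    ∃ s ∈ Ioo x y, ∃ v, IsRegular R s v := by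
  have hdense : Dense {s | ∃ v, IsRegular R s v} := Measure.dense_of_ae hR.area
  obtain ⟨s, hs, h⟩ := hdense.exists_between hxy
  exact ⟨s, h, hs⟩

/-- The derivative of a linear functional along an area parametrization is nonincreasing on an
interval where the functional is nonnegative. -/
theorem linear_velocity_antitone (hR : IsAreaParam K R) (hc : IsCompact K)
    (hconv : Convex ℝ K) (h0 : ((0, 0) : ℝ × ℝ) ∈ interior K) {I : Set ℝ} (hI : Convex ℝ I)
    {a b : ℝ} (hpos : ∀ θ ∈ I, 0 ≤ a * (R θ).1 + b * (R θ).2) {θ τ : ℝ} {v w : ℝ × ℝ}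
    (hθI : θ ∈ I) (hτI : τ ∈ I) (hv : IsRegular R θ v) (hw : IsRegular R τ w) (hθτ : θ < τ) :
    a * w.1 + b * w.2 ≤ a * v.1 + b * v.2 := by
  obtain ⟨δ, hδ, hcross⟩ := hR.exists_pos_cross hc hconv h0
  obtain ⟨n, hn⟩ := exists_nat_gt ((τ - θ) / (δ / 2))
  rw [div_lt_iff₀ (by positivity)] at hn
  induction n generalizing θ v with
  | zero => simp at hn; linarith
  | succ n ih =>
    by_cases hnear : τ - θ < δ
    · exact hR.linear_velocity_le_of_cross_pos hc hconv h0 hv hw (hcross θ τ hθτ hnear)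
        (hpos θ hθI) (hpos τ hτI)
    · obtain ⟨s, hs, u, hu⟩ := hR.exists_isRegular_mem_Ioo
        (show θ + δ / 2 < θ + δ by linarith)
      have hsτ : s < τ := by linarith [hs.2]
      have hθs : θ < s := by linarith [hs.1]
      have hsI : s ∈ I := hI.ordConnected.out hθI hτI ⟨hθs.le, hsτ.le⟩
      push_cast at hn
      refine (ih hsI hu hsτ (by linarith [hs.1])).trans ?_
      exact hR.linear_velocity_le_of_cross_pos hc hconv h0 hv hu
        (hcross θ s hθs (by linarith [hs.2])) (hpos θ hθI) (hpos s hsI)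

theorem concaveOn_linear (hR : IsAreaParam K R) (hc : IsCompact K)
    (hconv : Convex ℝ K) (h0 : ((0, 0) : ℝ × ℝ) ∈ interior K) {I : Set ℝ} (hI : Convex ℝ I)
    {a b : ℝ} (hpos : ∀ θ ∈ I, 0 ≤ a * (R θ).1 + b * (R θ).2) :
    ConcaveOn ℝ I fun θ => a * (R θ).1 + b * (R θ).2 := by
  refine concaveOn_of_slope_anti_adjacent hI fun {x y z} hx hz hxy hyz => ?_
  have hIcc : Icc x z ⊆ I := hI.ordConnected.out hx hz
  have hxI : Ioo x y ⊆ I := fun s hs => hIcc ⟨hs.1.le, hs.2.le.trans hyz.le⟩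
  have hzI : Ioo y z ⊆ I := fun s hs => hIcc ⟨hxy.le.trans hs.1.le, hs.2.le⟩
  have hae : ∀ᵐ s : ℝ, ∃ v, IsRegular R s v := hR.area
  set S := {d : ℝ | ∃ s ∈ Ioo x y, ∃ v, IsRegular R s v ∧ d = a * v.1 + b * v.2} with hS
  have hSne : S.Nonempty := by
    obtain ⟨s, hs, v, hv⟩ := hR.exists_isRegular_mem_Ioo hxy
    exact ⟨_, s, hs, v, hv, rfl⟩
  have hlow : ∀ t ∈ Ioo y z, ∀ w, IsRegular R t w → ∀ d ∈ S, a * w.1 + b * w.2 ≤ d := by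
    rintro t ht w hw _ ⟨s, hs, v, hv, rfl⟩
    exact hR.linear_velocity_antitone hc hconv h0 hI hpos (hxI hs) (hzI ht) hv hw
      (hs.2.trans ht.1)
  have hbdd : BddBelow S := by
    obtain ⟨t, ht, w, hw⟩ := hR.exists_isRegular_mem_Ioo hyz
    exact ⟨_, hlow t ht w hw⟩
  trans sInf S
  · rw [div_le_iff₀ (by linarith)]
    have h := (hR.locallyLipschitz_linear (-a) (-b)).mul_sub_le_sub_of_ae_hasDerivAt
      (c := -sInf S) hyz.le <| by
        filter_upwards [hae] with t ⟨w, hw⟩ ht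
        refine ⟨_, hw.hasDerivAt_linear _ _, ?_⟩
        linarith [le_csInf hSne (hlow t ht w hw)]
    linarith
  · rw [le_div_iff₀ (by linarith)]
    refine (hR.locallyLipschitz_linear a b).mul_sub_le_sub_of_ae_hasDerivAt hxy.le ?_
    filter_upwards [hae] with s ⟨v, hv⟩ hs
    exact ⟨_, hv.hasDerivAt_linear _ _, csInf_le hbdd ⟨s, hs, v, hv, rfl⟩⟩

end IsAreaParam

/-- The convex trigonometric functions `cos_Ω = P₁` and `sin_Ω = P₂` are concave on
every interval where they are non-negative, and convex on every interval where they
are non-positive. -/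
theorem areaParam_concave_convex
    (Ω : Set (ℝ × ℝ)) (hΩc : IsCompact Ω) (hΩconv : Convex ℝ Ω)
    (hΩ0 : ((0, 0) : ℝ × ℝ) ∈ interior Ω)
    (P : ℝ → ℝ × ℝ) (hP : IsAreaParam Ω P)
    (I : Set ℝ) (hI : Convex ℝ I) :
    ((∀ θ ∈ I, 0 ≤ (P θ).2) → ConcaveOn ℝ I fun θ => (P θ).2) ∧
    ((∀ θ ∈ I, (P θ).2 ≤ 0) → ConvexOn ℝ I fun θ => (P θ).2) ∧
    ((∀ θ ∈ I, 0 ≤ (P θ).1) → ConcaveOn ℝ I fun θ => (P θ).1) ∧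
    ((∀ θ ∈ I, (P θ).1 ≤ 0) → ConvexOn ℝ I fun θ => (P θ).1) := by
  have hcv := fun a b => hP.concaveOn_linear hΩc hΩconv hΩ0 hI (a := a) (b := b)
  refine ⟨fun h => ?_, fun h => ?_, fun h => ?_, fun h => ?_⟩
  · simpa using hcv 0 1 (by simpa using h)
  · rw [← neg_concaveOn_iff]
    simpa [Pi.neg_def] using hcv 0 (-1) (by simpa using h)
  · simpa using hcv 1 0 (by simpa using h)
  · rw [← neg_concaveOn_iff]
    simpa [Pi.neg_def] using hcv (-1) 0 (by simpa using h)
end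

section
/- Let Ω ⊂ ℝ² be a compact convex set with 0 in its interior and let P = (P₁,P₂) be an area parametrization of ∂Ω. Fix θ ∈ ℝ and a nonzero constant k ∈ ℝ, and define g(t) := P₂(θ)·P₁(θ+kt) − P₁(θ)·P₂(θ+kt) (in the paper's notation g(t) = sin_Ω(θ)cos_Ω(θ+kt) − cos_Ω(θ)sin_Ω(θ+kt)). Then there exists δ > 0 such that: if k > 0, g is convex on [0,δ] and concave on [−δ,0]; if k < 0, g is concave on [0,δ] and convex on [−δ,0]. -/
open MeasureTheory

open Set Filter Topology

theorem AbsolutelyContinuousOnInterval.mul_sub_le_sub_of_ae_le_deriv {f : ℝ → ℝ} {a b c : ℝ}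
    (hf : AbsolutelyContinuousOnInterval f a b) (hab : a ≤ b)
    (hc : ∀ᵐ x, x ∈ Icc a b → c ≤ deriv f x) : c * (b - a) ≤ f b - f a := by
  rw [← hf.integral_deriv_eq_sub]
  have h := intervalIntegral.integral_mono_ae_restrict (μ := volume) hab
    (intervalIntegrable_const (c := c)) hf.intervalIntegrable_deriv
    ((ae_restrict_iff' measurableSet_Icc).2 hc)
  simpa [mul_comm] using h

theorem AbsolutelyContinuousOnInterval.sub_le_mul_sub_of_ae_deriv_le {f : ℝ → ℝ} {a b c : ℝ}
    (hf : AbsolutelyContinuousOnInterval f a b) (hab : a ≤ b)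
    (hc : ∀ᵐ x, x ∈ Icc a b → deriv f x ≤ c) : f b - f a ≤ c * (b - a) := by
  rw [← hf.integral_deriv_eq_sub]
  have h := intervalIntegral.integral_mono_ae_restrict (μ := volume) hab
    hf.intervalIntegrable_deriv (intervalIntegrable_const (c := c))
    ((ae_restrict_iff' measurableSet_Icc).2 hc)
  simpa [mul_comm] using h

/-- An absolutely continuous function whose derivative is monotone on a set of full measure
is convex. -/
theorem AbsolutelyContinuousOnInterval.convexOn_of_monotoneOn_deriv {f : ℝ → ℝ} {a b : ℝ}
    (hf : AbsolutelyContinuousOnInterval f a b) {G : Set ℝ} (hG : ∀ᵐ x, x ∈ G)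
    (hmono : MonotoneOn (deriv f) (G ∩ Icc a b)) : ConvexOn ℝ (Icc a b) f := by
  refine convexOn_of_slope_mono_adjacent (convex_Icc a b) fun {x y z} hx hz hxy hyz => ?_
  have hsub {u v : ℝ} (hu : x ≤ u) (huv : u ≤ v) (hv : v ≤ z) :
      AbsolutelyContinuousOnInterval f u v := by
    refine hf.mono ?_
    rw [uIcc_of_le huv, uIcc_of_le (hx.1.trans hx.2)]
    exact Icc_subset_Icc (hx.1.trans hu) (hv.trans hz.2)
  rw [div_le_iff₀ (sub_pos.2 hxy)]
  refine (hsub le_rfl hxy.le hyz.le).sub_le_mul_sub_of_ae_deriv_le hxy.le ?_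
  filter_upwards [hG] with u huG hu
  rw [le_div_iff₀ (sub_pos.2 hyz)]
  refine (hsub hxy.le hyz.le le_rfl).mul_sub_le_sub_of_ae_le_deriv hyz.le ?_
  filter_upwards [hG] with v hvG hv
  exact hmono ⟨huG, hx.1.trans hu.1, hu.2.trans (hyz.le.trans hz.2)⟩
    ⟨hvG, hx.1.trans (hxy.le.trans hv.1), hv.2.trans hz.2⟩ (hu.2.trans hv.1)

/-- An absolutely continuous function whose derivative is antitone on a set of full measure
is concave. -/
theorem AbsolutelyContinuousOnInterval.concaveOn_of_antitoneOn_deriv {f : ℝ → ℝ} {a b : ℝ}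
    (hf : AbsolutelyContinuousOnInterval f a b) {G : Set ℝ} (hG : ∀ᵐ x, x ∈ G)
    (hanti : AntitoneOn (deriv f) (G ∩ Icc a b)) : ConcaveOn ℝ (Icc a b) f := by
  rw [← neg_convexOn_iff]
  refine hf.neg.convexOn_of_monotoneOn_deriv hG fun x hx y hy hxy => ?_
  simpa [deriv.neg] using hanti hx hy hxy

/-- The determinant of a pair of plane vectors. -/
def cross2 (p q : ℝ × ℝ) : ℝ := p.1 * q.2 - p.2 * q.1

theorem hasDerivAt_cross2 {P : ℝ → ℝ × ℝ} {v : ℝ × ℝ} {x : ℝ} (p : ℝ × ℝ)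
    (h : HasDerivAt P v x) : HasDerivAt (fun u => cross2 p (P u)) (cross2 p v) x := by
  have h₁ : HasDerivAt (fun u => (P u).1) v.1 x :=
    (hasFDerivAt_fst (𝕜 := ℝ) (p := P x)).comp_hasDerivAt x h
  have h₂ : HasDerivAt (fun u => (P u).2) v.2 x :=
    (hasFDerivAt_snd (𝕜 := ℝ) (p := P x)).comp_hasDerivAt x h
  exact (h₂.const_mul p.1).sub (h₁.const_mul p.2)

theorem absolutelyContinuousOnInterval_cross2 {P : ℝ → ℝ × ℝ} {C : NNReal} {a b : ℝ}
    (h : LipschitzOnWith C P (uIcc a b)) (p : ℝ × ℝ) :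
    AbsolutelyContinuousOnInterval (fun u => cross2 p (P u)) a b :=
  ((LipschitzWith.prod_snd.comp_lipschitzOnWith h).absolutelyContinuousOnInterval.const_mul
    p.1).sub
  ((LipschitzWith.prod_fst.comp_lipschitzOnWith h).absolutelyContinuousOnInterval.const_mul p.2)

theorem abs_cross2_le (p q : ℝ × ℝ) : |cross2 p q| ≤ 2 * (‖p‖ * ‖q‖) := by
  have h₁ : |p.1 * q.2| ≤ ‖p‖ * ‖q‖ := by
    rw [abs_mul]
    exact mul_le_mul (norm_fst_le p) (norm_snd_le q) (abs_nonneg _) (norm_nonneg _)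
  have h₂ : |p.2 * q.1| ≤ ‖p‖ * ‖q‖ := by
    rw [abs_mul]
    exact mul_le_mul (norm_snd_le p) (norm_fst_le q) (abs_nonneg _) (norm_nonneg _)
  calc |cross2 p q| ≤ |p.1 * q.2| + |p.2 * q.1| := abs_sub _ _
    _ ≤ _ := by linarith

/-- The parameters at which an area parametrization is differentiable with unit area speed. -/
def areaRegular (P : ℝ → ℝ × ℝ) : Set ℝ :=
  {u | DifferentiableAt ℝ P u ∧ cross2 (P u) (deriv P u) = 1}

namespace IsAreaParam

variable {K : Set (ℝ × ℝ)} {P : ℝ → ℝ × ℝ}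

theorem ae_mem_areaRegular (hP : IsAreaParam K P) : ∀ᵐ u, u ∈ areaRegular P := by
  filter_upwards [hP.area] with u ⟨v, hv, h⟩
  exact ⟨hv.differentiableAt, by rw [hv.deriv]; exact h⟩

theorem mem (hP : IsAreaParam K P) (hK : IsCompact K) (u : ℝ) : P u ∈ K :=
  hK.isClosed.frontier_subset (hP.mem_frontier u)

/-- The tangent line at a regular parameter supports the convex body. -/
theorem cross2_deriv_le_one (hP : IsAreaParam K P) (hK : IsCompact K) (hconv : Convex ℝ K)
    (h0 : ((0, 0) : ℝ × ℝ) ∈ interior K) {u : ℝ} (hu : u ∈ areaRegular P) {x : ℝ × ℝ}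
    (hx : x ∈ K) : cross2 x (deriv P u) ≤ 1 := by
  obtain ⟨f, hf⟩ := geometric_hahn_banach_open_point hconv.interior isOpen_interior
    (hP.mem_frontier u).2
  have hle : ∀ y ∈ K, f y ≤ f (P u) := by
    intro y hy
    have hy' : y ∈ closure (interior K) := by
      rw [hconv.closure_interior_eq_closure_of_nonempty_interior ⟨_, h0⟩]
      exact subset_closure hy
    exact closure_minimal (fun a ha => (hf a ha).le)
      (isClosed_le f.continuous continuous_const) hy'
  have hpos : 0 < f (P u) := by
    have := hf _ h0
    rwa [show ((0, 0) : ℝ × ℝ) = 0 from rfl, map_zero] at this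
  have hmax : IsLocalMax (fun t => f (P t)) u :=
    Eventually.of_forall fun t => hle _ (hP.mem hK t)
  have hv : f (deriv P u) = 0 :=
    hmax.hasDerivAt_eq_zero (f.hasFDerivAt.comp_hasDerivAt u hu.1.hasDerivAt)
  have hcoord (y : ℝ × ℝ) : f y = y.1 * f (1, 0) + y.2 * f (0, 1) := by
    conv_lhs => rw [show y = y.1 • ((1, 0) : ℝ × ℝ) + y.2 • ((0, 1) : ℝ × ℝ) by ext <;> simp]
    rw [map_add, map_smul, map_smul, smul_eq_mul, smul_eq_mul]
  have hkey : f (P u) * cross2 x (deriv P u) = f x := by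
    have hu' := hu.2
    rw [hcoord] at hv
    rw [hcoord, hcoord x]
    unfold cross2 at *
    linear_combination (x.1 * f (1, 0) + x.2 * f (0, 1)) * hu'
      + (x.1 * (P u).2 - x.2 * (P u).1) * hv
  have := hle x hx
  rw [← hkey] at this
  exact le_of_mul_le_mul_left (by linarith) hpos

/-- Nearby boundary points are ordered counterclockwise by the parameter. -/
theorem exists_lipschitzOnWith_cross2_pos (hP : IsAreaParam K P) (θ : ℝ) :
    ∃ ε > 0, ∃ C, LipschitzOnWith C P (Icc (θ - ε) (θ + ε)) ∧
      ∀ φ ∈ Icc (θ - ε) (θ + ε), ∀ ψ ∈ Icc (θ - ε) (θ + ε), φ < ψ →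
        0 < cross2 (P φ) (P ψ) := by
  obtain ⟨C, s, hs, hC⟩ := hP.lipschitz θ
  obtain ⟨r, hr, hrs⟩ := Metric.mem_nhds_iff.1 hs
  set ε := min (r / 2) (1 / (8 * ((C : ℝ) ^ 2 + 1))) with hε
  have hε0 : 0 < ε := by positivity
  have hεr : ε < r := (min_le_left _ _).trans_lt (by linarith)
  have hεC : 8 * ((C : ℝ) ^ 2 * ε) ≤ 1 := by
    have h := min_le_right (r / 2) (1 / (8 * ((C : ℝ) ^ 2 + 1)))
    rw [← hε, le_div_iff₀ (by positivity)] at h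
    nlinarith
  have hball : Icc (θ - ε) (θ + ε) ⊆ Metric.ball θ r := by
    rw [Real.ball_eq_Ioo]
    exact fun x hx => ⟨by linarith [hx.1], by linarith [hx.2]⟩
  have hlip := hC.mono (hball.trans hrs)
  refine ⟨ε, hε0, C, hlip, fun φ hφ ψ hψ hφψ => ?_⟩
  have hsub : Icc φ ψ ⊆ Icc (θ - ε) (θ + ε) := Icc_subset_Icc hφ.1 hψ.2
  have hac := absolutelyContinuousOnInterval_cross2 (C := C) (P := P) (a := φ) (b := ψ)
    (by rw [uIcc_of_le hφψ.le]; exact hlip.mono hsub) (P φ)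
  have hmain := hac.mul_sub_le_sub_of_ae_le_deriv (c := 1 / 2) hφψ.le (by
    filter_upwards [hP.ae_mem_areaRegular] with u hu hmem
    rw [(hasDerivAt_cross2 _ hu.1.hasDerivAt).deriv]
    have hd : ‖deriv P u‖ ≤ C := hu.1.hasDerivAt.le_of_lipschitzOn
      (mem_of_superset (Metric.isOpen_ball.mem_nhds (hball (hsub hmem))) hrs) hC
    have hdist : ‖P u - P φ‖ ≤ C * (2 * ε) := by
      refine (hlip.norm_sub_le (hsub hmem) hφ).trans ?_
      rw [Real.norm_of_nonneg (by linarith [hmem.1])]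
      gcongr
      linarith [hφ.1, hψ.2, hmem.2]
    have hcross := (abs_le.1 (abs_cross2_le (P u - P φ) (deriv P u))).2
    have hprod : ‖P u - P φ‖ * ‖deriv P u‖ ≤ C * (2 * ε) * C :=
      mul_le_mul hdist hd (norm_nonneg _) (by positivity)
    have hsplit : cross2 (P φ) (deriv P u)
        = cross2 (P u) (deriv P u) - cross2 (P u - P φ) (deriv P u) := by
      simp only [cross2, Prod.fst_sub, Prod.snd_sub]
      ring
    rw [hsplit, hu.2]
    nlinarith)
  have hself : cross2 (P φ) (P φ) = 0 := by
    unfold cross2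
    ring
  rw [hself] at hmain
  linarith

/-- Locally, the area form against a fixed boundary point is concave after that point and convex
before it. -/
theorem exists_concaveOn_convexOn (hP : IsAreaParam K P) (hK : IsCompact K) (hconv : Convex ℝ K)
    (h0 : ((0, 0) : ℝ × ℝ) ∈ interior K) (θ : ℝ) :
    ∃ ε > 0, ConcaveOn ℝ (Icc θ (θ + ε)) (fun u => cross2 (P θ) (P u)) ∧
      ConvexOn ℝ (Icc (θ - ε) θ) (fun u => cross2 (P θ) (P u)) := by
  obtain ⟨ε, hε, C, hlip, hpos⟩ := hP.exists_lipschitzOnWith_cross2_pos θ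
  have hθ : θ ∈ Icc (θ - ε) (θ + ε) := ⟨by linarith, by linarith⟩
  have hright : Icc θ (θ + ε) ⊆ Icc (θ - ε) (θ + ε) := Icc_subset_Icc hθ.1 le_rfl
  have hleft : Icc (θ - ε) θ ⊆ Icc (θ - ε) (θ + ε) := Icc_subset_Icc le_rfl hθ.2
  have hnonneg : ∀ φ ∈ Icc (θ - ε) (θ + ε), ∀ ψ ∈ Icc (θ - ε) (θ + ε), φ ≤ ψ →
      0 ≤ cross2 (P φ) (P ψ) := by
    intro φ hφ ψ hψ h
    rcases h.eq_or_lt with rfl | h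
    · exact le_of_eq (by unfold cross2; ring)
    · exact (hpos φ hφ ψ hψ h).le
  have hsupp {u : ℝ} (hu : u ∈ areaRegular P) (w : ℝ) : cross2 (P w) (deriv P u) ≤ 1 :=
    hP.cross2_deriv_le_one hK hconv h0 hu (hP.mem hK w)
  refine ⟨ε, hε, ?_, ?_⟩
  · refine (absolutelyContinuousOnInterval_cross2 (hlip.mono (by
      rwa [uIcc_of_le hθ.2])) (P θ)).concaveOn_of_antitoneOn_deriv hP.ae_mem_areaRegular ?_
    rintro φ ⟨hφ, hφm⟩ ψ ⟨hψ, hψm⟩ hle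
    rcases hle.eq_or_lt with rfl | hlt
    · exact le_rfl
    rw [(hasDerivAt_cross2 _ hφ.1.hasDerivAt).deriv, (hasDerivAt_cross2 _ hψ.1.hasDerivAt).deriv]
    have hp := hpos φ (hright hφm) ψ (hright hψm) hlt
    have h₁ := mul_nonneg (hnonneg θ hθ ψ (hright hψm) hψm.1) (sub_nonneg.2 (hsupp hψ φ))
    have h₂ := mul_nonneg (hnonneg θ hθ φ (hright hφm) hφm.1) (sub_nonneg.2 (hsupp hφ ψ))
    have h₃ := hφ.2
    have h₄ := hψ.2
    refine le_of_mul_le_mul_left ?_ hp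
    have key (v : ℝ × ℝ) : cross2 (P φ) (P ψ) * cross2 (P θ) v
        = cross2 (P θ) (P ψ) * cross2 (P φ) v - cross2 (P θ) (P φ) * cross2 (P ψ) v := by
      unfold cross2
      ring
    rw [key, key, h₃, h₄]
    linarith
  · refine (absolutelyContinuousOnInterval_cross2 (hlip.mono (by
      rwa [uIcc_of_le hθ.1])) (P θ)).convexOn_of_monotoneOn_deriv hP.ae_mem_areaRegular ?_
    rintro φ ⟨hφ, hφm⟩ ψ ⟨hψ, hψm⟩ hle
    rcases hle.eq_or_lt with rfl | hlt
    · exact le_rfl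
    rw [(hasDerivAt_cross2 _ hφ.1.hasDerivAt).deriv, (hasDerivAt_cross2 _ hψ.1.hasDerivAt).deriv]
    have hp := hpos φ (hleft hφm) ψ (hleft hψm) hlt
    have h₁ := mul_nonneg (hnonneg ψ (hleft hψm) θ hθ hψm.2) (sub_nonneg.2 (hsupp hψ φ))
    have h₂ := mul_nonneg (hnonneg φ (hleft hφm) θ hθ hφm.2) (sub_nonneg.2 (hsupp hφ ψ))
    have h₃ := hφ.2
    have h₄ := hψ.2
    refine le_of_mul_le_mul_left ?_ hp
    have key (v : ℝ × ℝ) : cross2 (P φ) (P ψ) * cross2 (P θ) v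
        = cross2 (P φ) (P θ) * cross2 (P ψ) v - cross2 (P ψ) (P θ) * cross2 (P φ) v := by
      unfold cross2
      ring
    rw [key, key, h₃, h₄]
    linarith

end IsAreaParam


/-- Local convexity/concavity of `g(t) = sin_Ω(θ)cos_Ω(θ+kt) − cos_Ω(θ)sin_Ω(θ+kt)`
around `t = 0`: convex for positive times and concave for negative times if `k > 0`,
and vice versa if `k < 0`. -/
theorem g_local_convexity
    (Ω : Set (ℝ × ℝ)) (hΩc : IsCompact Ω) (hΩconv : Convex ℝ Ω)
    (hΩ0 : ((0, 0) : ℝ × ℝ) ∈ interior Ω)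
    (P : ℝ → ℝ × ℝ) (hP : IsAreaParam Ω P)
    (θ k : ℝ) (hk : k ≠ 0) :
    ∃ δ > (0:ℝ),
      (0 < k →
        ConvexOn ℝ (Set.Icc 0 δ)
          (fun t => (P θ).2 * (P (θ + k * t)).1 - (P θ).1 * (P (θ + k * t)).2) ∧
        ConcaveOn ℝ (Set.Icc (-δ) 0)
          (fun t => (P θ).2 * (P (θ + k * t)).1 - (P θ).1 * (P (θ + k * t)).2)) ∧
      (k < 0 →
        ConcaveOn ℝ (Set.Icc 0 δ)
          (fun t => (P θ).2 * (P (θ + k * t)).1 - (P θ).1 * (P (θ + k * t)).2) ∧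
        ConvexOn ℝ (Set.Icc (-δ) 0)
          (fun t => (P θ).2 * (P (θ + k * t)).1 - (P θ).1 * (P (θ + k * t)).2)) := by
  obtain ⟨ε, hε, hr, hl⟩ := hP.exists_concaveOn_convexOn hΩc hΩconv hΩ0 θ
  let A : ℝ →ᵃ[ℝ] ℝ := AffineMap.lineMap θ (θ + k)
  have hA (t : ℝ) : A t = θ + k * t := by
    simp only [A, AffineMap.lineMap_apply_module', smul_eq_mul]
    ring
  have hfun : (fun t => (P θ).2 * (P (θ + k * t)).1 - (P θ).1 * (P (θ + k * t)).2)
      = (-fun u => cross2 (P θ) (P u)) ∘ A := by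
    funext t
    simp only [Function.comp_apply, Pi.neg_apply, hA, cross2]
    ring
  have hcr := hr.neg.comp_affineMap A
  have hcl := hl.neg.comp_affineMap A
  rw [hfun]
  refine ⟨ε / |k|, by positivity, fun hk => ?_, fun hk => ?_⟩
  · rw [abs_of_pos hk]
    have hkε : k * (ε / k) = ε := mul_div_cancel₀ ε hk.ne'
    refine ⟨hcr.subset (fun t ht => ?_) (convex_Icc _ _),
      hcl.subset (fun t ht => ?_) (convex_Icc _ _)⟩ <;>
    · rw [mem_preimage, hA]
      have h₁ := mul_le_mul_of_nonneg_left ht.1 hk.le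
      have h₂ := mul_le_mul_of_nonneg_left ht.2 hk.le
      constructor <;> linarith
  · rw [abs_of_neg hk]
    have hkε : k * (ε / -k) = -ε := by
      field_simp
    refine ⟨hcl.subset (fun t ht => ?_) (convex_Icc _ _),
      hcr.subset (fun t ht => ?_) (convex_Icc _ _)⟩ <;>
    · rw [mem_preimage, hA]
      have h₁ := mul_le_mul_of_nonpos_left ht.1 hk.le
      have h₂ := mul_le_mul_of_nonpos_left ht.2 hk.le
      constructor <;> linarith
end

section
/- Let K ⊂ ℝ² be a compact convex set with 0 in its interior and let Q be an area parametrization of ∂K. Suppose x̄ > 0 and y₀ < y₁ are such that the vertical segment {x̄} × [y₀,y₁] is contained in the frontier of K, and suppose ψ₀ ∈ ℝ satisfies Q(ψ₀) = (x̄, y₀). Then Q(ψ₀ + (y−y₀)·x̄) = (x̄, y) for every y ∈ [y₀, y₁]; i.e. on a flat vertical part of the boundary the area parametrization moves affinely with vertical speed 1/x̄. -/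
open MeasureTheory

open Set Filter Topology

/-- A ray from an interior point `0` of a convex set meets the frontier at most once. -/
theorem Convex.eq_one_of_smul_mem_frontier {E : Type*} [NormedAddCommGroup E] [NormedSpace ℝ E]
    {K : Set E} (hK : Convex ℝ K) (h0 : (0 : E) ∈ interior K) {p : E} {c : ℝ} (hc : 0 < c)
    (hp : p ∈ frontier K) (hcp : c • p ∈ frontier K) : c = 1 := by
  have key : ∀ {q : E} {d : ℝ}, 0 < d → q ∈ frontier K → d • q ∈ frontier K → 1 ≤ d := by
    intro q d hd hq hdq
    by_contra! h
    refine hdq.2 ?_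
    simpa using hK.combo_interior_closure_mem_interior h0 hq.1 (sub_pos.2 h) hd.le
      (sub_add_cancel 1 d)
  refine le_antisymm ?_ (key hc hp hcp)
  have h := key (inv_pos.2 hc) hcp (by simpa [smul_smul, hc.ne'] using hp)
  exact (one_le_inv₀ hc).1 h

theorem HasDerivAt.snd_div_fst {R : ℝ → ℝ × ℝ} {v : ℝ × ℝ} {θ : ℝ} (hR : HasDerivAt R v θ)
    (h : (R θ).1 ≠ 0) :
    HasDerivAt (fun s => (R s).2 / (R s).1)
      (((R θ).1 * v.2 - (R θ).2 * v.1) / (R θ).1 ^ 2) θ := by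
  have h1 : HasDerivAt (fun s => (R s).1) v.1 θ := hR.fst
  have h2 : HasDerivAt (fun s => (R s).2) v.2 θ := hR.snd
  exact (h2.div h1 h).congr_deriv (by ring)

/-- Near a point of the open right half plane, the slope `R₂ / R₁` of an area parametrization
is the integral of `1 / R₁²`. -/
theorem IsAreaParam.eventually_slope_sub_eq_integral {K : Set (ℝ × ℝ)} {R : ℝ → ℝ × ℝ}
    (hR : IsAreaParam K R) {x : ℝ} (hx : 0 < (R x).1) :
    ∃ u ∈ 𝓝 x, ∀ a b, uIcc a b ⊆ u →
      (R b).2 / (R b).1 - (R a).2 / (R a).1 = ∫ θ in a..b, 1 / (R θ).1 ^ 2 := by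
  have hcd : ContDiffAt ℝ 1 (fun p : ℝ × ℝ => p.2 / p.1) (R x) :=
    contDiffAt_snd.div contDiffAt_fst hx.ne'
  obtain ⟨C, t, ht, hC⟩ := hcd.exists_lipschitzOnWith
  obtain ⟨D, s, hs, hD⟩ := hR.lipschitz x
  have hcont : Continuous R := hR.lipschitz.continuous
  have hpos : ∀ᶠ θ in 𝓝 x, 0 < (R θ).1 :=
    (hcont.fst.tendsto x).eventually (lt_mem_nhds hx)
  refine ⟨s ∩ R ⁻¹' t ∩ {θ | 0 < (R θ).1},
    inter_mem (inter_mem hs (hcont.continuousAt.preimage_mem_nhds ht)) hpos, fun a b hab => ?_⟩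
  have hlip : LipschitzOnWith (C * D) (fun θ => (R θ).2 / (R θ).1) (uIcc a b) :=
    hC.comp (hD.mono fun θ hθ => (hab hθ).1.1) fun θ hθ => (hab hθ).1.2
  rw [← hlip.absolutelyContinuousOnInterval.integral_deriv_eq_sub]
  refine intervalIntegral.integral_congr_ae ?_
  filter_upwards [hR.area] with θ hθ hmem
  obtain ⟨v, hv, hv1⟩ := hθ
  have hne : (R θ).1 ≠ 0 := (hab (uIoc_subset_uIcc hmem)).2.ne'
  rw [(hv.snd_div_fst hne).deriv, hv1]

/-- On a flat vertical part `{x̄} × [y₀,y₁]` of the boundary of `K`, an area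
parametrization moves affinely with vertical speed `1/x̄`:
`Q(ψ₀ + (y−y₀)·x̄) = (x̄, y)`. -/
theorem areaParam_on_flat_part
    (K : Set (ℝ × ℝ)) (hKc : IsCompact K) (hKconv : Convex ℝ K)
    (hK0 : ((0, 0) : ℝ × ℝ) ∈ interior K)
    (Q : ℝ → ℝ × ℝ) (hQ : IsAreaParam K Q)
    (xbar y₀ y₁ : ℝ) (hx : 0 < xbar) (hy : y₀ < y₁)
    (hseg : ∀ y ∈ Set.Icc y₀ y₁, ((xbar, y) : ℝ × ℝ) ∈ frontier K)
    (ψ₀ : ℝ) (hψ₀ : Q ψ₀ = (xbar, y₀)) :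
    ∀ y ∈ Set.Icc y₀ y₁, Q (ψ₀ + (y - y₀) * xbar) = (xbar, y) := by
  have hcont : Continuous Q := hQ.lipschitz.continuous
  set S : Set ℝ := {θ | Q θ = (xbar, y₀ + (θ - ψ₀) / xbar)} with hS
  have hclosed : IsClosed S := isClosed_eq hcont (by fun_prop)
  have hsub : Icc ψ₀ (ψ₀ + (y₁ - y₀) * xbar) ⊆ S := by
    refine IsClosed.Icc_subset_of_forall_exists_gt (hclosed.inter isClosed_Icc)
      (by simp [hS, hψ₀]) ?_
    rintro x ⟨hxS, hx0, hx1⟩ z hz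
    have hQx : Q x = (xbar, y₀ + (x - ψ₀) / xbar) := hxS
    have hx0' : 0 ≤ (x - ψ₀) / xbar := div_nonneg (sub_nonneg.2 hx0) hx.le
    have hx1' : (x - ψ₀) / xbar < y₁ - y₀ := by
      rw [div_lt_iff₀ hx]; linarith
    have hpos : 0 < (Q x).1 := by rw [hQx]; exact hx
    obtain ⟨u, hu, hint⟩ := hQ.eventually_slope_sub_eq_integral hpos
    have hQpos : ∀ᶠ θ in 𝓝 x, 0 < (Q θ).1 :=
      (hcont.fst.tendsto x).eventually (lt_mem_nhds hpos)
    have hQlt : ∀ᶠ θ in 𝓝 x, (Q θ).2 * xbar < y₁ * (Q θ).1 := by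
      refine ContinuousAt.eventually_lt (by fun_prop) (by fun_prop) ?_
      rw [hQx]
      nlinarith
    obtain ⟨ε, hε, hball⟩ := Metric.mem_nhds_iff.1 (inter_mem hu (hQpos.and hQlt))
    obtain ⟨w, hxw, hw⟩ := exists_between (lt_min hz (lt_add_of_pos_right x hε))
    have hwε : w < x + ε := hw.trans_le (min_le_right _ _)
    have hmem : ∀ θ ∈ Icc x w, θ ∈ u ∧ 0 < (Q θ).1 ∧ (Q θ).2 * xbar < y₁ * (Q θ).1 := by
      intro θ hθ
      refine hball ?_
      rw [Metric.mem_ball, Real.dist_eq, abs_lt]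
      constructor <;> linarith [hθ.1, hθ.2]
    have hslope : ∀ θ ∈ Icc x w,
        (Q θ).2 / (Q θ).1 - (Q x).2 / (Q x).1 = ∫ s in x..θ, 1 / (Q s).1 ^ 2 := by
      intro θ hθ
      refine hint x θ fun s hs => ?_
      rw [uIcc_of_le hθ.1] at hs
      exact (hmem s ⟨hs.1, hs.2.trans hθ.2⟩).1
    have hfst : ∀ θ ∈ Icc x w, (Q θ).1 = xbar := by
      intro θ hθ
      obtain ⟨-, hθpos, hθlt⟩ := hmem θ hθ
      have hnonneg : 0 ≤ (Q θ).2 / (Q θ).1 - (Q x).2 / (Q x).1 := by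
        rw [hslope θ hθ]
        exact intervalIntegral.integral_nonneg hθ.1 fun s _ => by positivity
      have hge : y₀ / xbar ≤ (Q θ).2 / (Q θ).1 := by
        have : y₀ / xbar ≤ (Q x).2 / (Q x).1 := by
          rw [hQx]
          exact div_le_div_of_nonneg_right (by linarith) hx.le
        linarith
      rw [div_le_div_iff₀ hx hθpos] at hge
      have hc : 0 < xbar / (Q θ).1 := div_pos hx hθpos
      have hscale : (xbar / (Q θ).1) • Q θ = (xbar, (Q θ).2 * xbar / (Q θ).1) := by
        ext
        · simp [hθpos.ne']
        · simp only [Prod.smul_snd, smul_eq_mul]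
          ring
      have hone := hKconv.eq_one_of_smul_mem_frontier hK0 hc (hQ.mem_frontier θ) (by
        rw [hscale]
        exact hseg _ ⟨(le_div_iff₀ hθpos).2 hge, (div_le_iff₀ hθpos).2 hθlt.le⟩)
      exact ((div_eq_one_iff_eq hθpos.ne').1 hone).symm
    refine ⟨w, ?_, hxw, (hw.trans_le (min_le_left _ _)).le⟩
    have hwI : w ∈ Icc x w := right_mem_Icc.2 hxw.le
    have hconst : ∫ s in x..w, 1 / (Q s).1 ^ 2 = (w - x) * (1 / xbar ^ 2) := by
      rw [intervalIntegral.integral_congr (g := fun _ => 1 / xbar ^ 2),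
        intervalIntegral.integral_const, smul_eq_mul]
      intro s hs
      rw [uIcc_of_le hxw.le] at hs
      simp only [hfst s hs]
    have hfinal := hslope w hwI
    rw [hconst, hfst w hwI, hQx] at hfinal
    refine Prod.ext (hfst w hwI) ?_
    field_simp at hfinal ⊢
    linarith
  intro y hy'
  have hmem := hsub (show ψ₀ + (y - y₀) * xbar ∈ Icc ψ₀ (ψ₀ + (y₁ - y₀) * xbar) from
    ⟨by nlinarith [hy'.1], by nlinarith [hy'.2]⟩)
  have hQy : Q (ψ₀ + (y - y₀) * xbar) = (xbar, y₀ + (ψ₀ + (y - y₀) * xbar - ψ₀) / xbar) := hmem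
  rw [hQy, add_sub_cancel_left, mul_div_cancel_right₀ _ hx.ne', add_sub_cancel]
end

section
/- Let Ω ⊂ ℝ² be a compact convex set with 0 in its interior, Ω° its polar, P and Q area parametrizations of ∂Ω and ∂Ω°, and C : ℝ → ℝ a nondecreasing map with ⟨P(C(s)), Q(s)⟩ = 1 for every s; assume Q is differentiable everywhere with Q′(s) = (−P₂(C(s)), P₁(C(s))). Fix ψ ∈ ℝ such that C is differentiable at ψ and P is differentiable at C(ψ) with P′(C(ψ)) = (−Q₂(ψ), Q₁(ψ)). Then, as s → 0, 1 − ⟨Q(ψ+s), P(C(ψ))⟩ = ½·C′(ψ)·s² + o(s²). In the paper's notation: f_ψ(s) := 1 − sin_{Ω°}(ψ+s)sin_Ω(ψ_∘) − cos_{Ω°}(ψ+s)cos_Ω(ψ_∘) satisfies f_ψ(0) = 0, f_ψ′(0) = 0 and f_ψ(s) = ½C_∘′(ψ)s² + o(s²). -/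
open MeasureTheory

open Asymptotics

/-- If `g` vanishes at `0` and its derivative is `o(s)` there, then `g = o(s²)`. -/
theorem isLittleO_sq_of_hasDerivAt {g h : ℝ → ℝ} (hg : ∀ s, HasDerivAt g (h s) s)
    (hg0 : g 0 = 0) (hh : h =o[nhds (0:ℝ)] fun s => s) :
    g =o[nhds (0:ℝ)] fun s => s ^ 2 := by
  rw [isLittleO_iff] at hh ⊢
  intro ε hε
  obtain ⟨δ, hδ, hball⟩ := Metric.eventually_nhds_iff.1 (hh hε)
  refine Metric.eventually_nhds_iff.2 ⟨δ, hδ, fun x hx => ?_⟩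
  have bound : ∀ y ∈ Metric.closedBall (0:ℝ) |x|, ‖h y‖ ≤ ε * |x| := fun y hy => by
    have hyx : |y| ≤ |x| := by simpa using hy
    have hxδ : |x| < δ := by simpa using hx
    exact (hball (by simpa using hyx.trans_lt hxδ)).trans
      (mul_le_mul_of_nonneg_left hyx hε.le)
  have key := (convex_closedBall (0:ℝ) |x|).norm_image_sub_le_of_norm_hasDerivWithin_le
    (fun y _ => (hg y).hasDerivWithinAt) bound
    (Metric.mem_closedBall_self (abs_nonneg x)) (y := x) (by simp)
  simpa [hg0, pow_two, mul_assoc] using key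

theorem hasDerivAt_fst_snd {R : ℝ → ℝ × ℝ} {v : ℝ × ℝ} {s : ℝ} (hR : HasDerivAt R v s) :
    HasDerivAt (fun t => (R t).1) v.1 s ∧ HasDerivAt (fun t => (R t).2) v.2 s :=
  ⟨by simpa using (HasFDerivAt.fst hR.hasFDerivAt).hasDerivAt,
    by simpa using (HasFDerivAt.snd hR.hasFDerivAt).hasDerivAt⟩

/-- Second-order expansion of `f_ψ(s) = 1 − ⟨Q(ψ+s), P(C(ψ))⟩`: if the correspondence
map `C` is differentiable at `ψ` (with derivative `c'`) and `P` is differentiable at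
`C(ψ)` with `P′(C(ψ)) = (−Q₂(ψ), Q₁(ψ))`, then `f_ψ(s) = ½ c' s² + o(s²)` as `s → 0`. -/
theorem fpsi_second_order_expansion
    (Ω : Set (ℝ × ℝ)) (hΩc : IsCompact Ω) (hΩconv : Convex ℝ Ω)
    (hΩ0 : ((0, 0) : ℝ × ℝ) ∈ interior Ω)
    (P : ℝ → ℝ × ℝ) (hP : IsAreaParam Ω P)
    (Q : ℝ → ℝ × ℝ) (hQ : IsAreaParam (polar2 Ω) Q)
    (C : ℝ → ℝ) (hCmono : Monotone C)
    (hCorr : ∀ s, dot2 (P (C s)) (Q s) = 1)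
    (hQ' : ∀ s, HasDerivAt Q (-(P (C s)).2, (P (C s)).1) s)
    (ψ c' : ℝ) (hC' : HasDerivAt C c' ψ)
    (hP' : HasDerivAt P (-(Q ψ).2, (Q ψ).1) (C ψ)) :
    (fun s => (1 - dot2 (Q (ψ + s)) (P (C ψ))) - c' * s ^ 2 / 2)
      =o[nhds (0:ℝ)] fun s => s ^ 2 := by
  refine isLittleO_sq_of_hasDerivAt
    (h := fun s => (P (C ψ)).1 * (P (C (ψ + s))).2 - (P (C ψ)).2 * (P (C (ψ + s))).1 - c' * s)
    (fun s => ?_) ?_ ?_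
  · obtain ⟨hQ₁, hQ₂⟩ := hasDerivAt_fst_snd ((hQ' (ψ + s)).comp_const_add ψ s)
    convert! (((hQ₁.mul_const (P (C ψ)).1).add
      (hQ₂.mul_const (P (C ψ)).2)).const_sub 1).sub
      (((hasDerivAt_pow 2 s).const_mul c').div_const 2) using 1
    push_cast
    ring
  · have h := hCorr ψ
    simp only [dot2, add_zero] at h ⊢
    linarith
  · have hPC : HasDerivAt (fun s => P (C s)) (c' • (-(Q ψ).2, (Q ψ).1)) (ψ + 0) := by
      rw [add_zero]
      exact hP'.scomp ψ hC'
    obtain ⟨hP₁, hP₂⟩ := hasDerivAt_fst_snd (hPC.comp_const_add ψ 0)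
    have hd := ((hP₂.const_mul (P (C ψ)).1).sub (hP₁.const_mul (P (C ψ)).2)).sub
      ((hasDerivAt_id (0:ℝ)).const_mul c')
    have h := hCorr ψ
    simp only [dot2] at h
    have hzero : (P (C ψ)).1 * (c' • (-(Q ψ).2, (Q ψ).1)).2
        - (P (C ψ)).2 * (c' • (-(Q ψ).2, (Q ψ).1)).1 - c' * 1 = 0 := by
      simp only [Prod.smul_mk, smul_eq_mul]
      linear_combination c' * h
    rw [hzero, hasDerivAt_iff_isLittleO] at hd
    refine hd.congr (fun s => ?_) (fun s => sub_zero s)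
    simp
    ring
end

section
/- Let f : ℝ → ℝ be a concave C¹ function and α₀ < β₀ real numbers with f(α₀) = f(β₀) = 0 and f > 0 on (α₀,β₀). For i = 1,2 let 0 ≤ s₁ < s₂ < sup f and let αᵢ < βᵢ in [α₀,β₀] satisfy f(αᵢ) = f(βᵢ) = sᵢ and f > sᵢ on (αᵢ,βᵢ). Set a(sᵢ) := ∫_{αᵢ}^{βᵢ} (f(t) − sᵢ) dt and d(sᵢ) := βᵢ − αᵢ. Then a(s₁)/d(s₁)² > a(s₂)/d(s₂)²; i.e. the ratio s ↦ a(s)/d(s)² is strictly decreasing on [0, sup f). -/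
/-- The integral over an interval of an affine function, given by its value and slope at the
left endpoint. -/
theorem integral_affine (a b c m : ℝ) :
    ∫ t in a..b, (c + m * (t - a)) = c * (b - a) + m * (b - a) ^ 2 / 2 := by
  have h : ∀ t ∈ Set.uIcc a b,
      HasDerivAt (fun t => c * (t - a) + m * (t - a) ^ 2 / 2) (c + m * (t - a)) t := by
    intro t _
    have h₁ : HasDerivAt (fun t : ℝ => t - a) 1 t := (hasDerivAt_id t).sub_const a
    exact ((h₁.const_mul c).add (((h₁.pow 2).const_mul m).div_const 2)).congr_deriv
      (by push_cast; ring)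
  rw [intervalIntegral.integral_eq_sub_of_hasDerivAt h
    (by apply Continuous.intervalIntegrable; fun_prop)]
  ring

/-- The chord inequality for concave functions, without denominators. -/
theorem ConcaveOn.chord_mul_le {f : ℝ → ℝ} (hf : ConcaveOn ℝ Set.univ f) {x y z : ℝ}
    (hxy : x ≤ y) (hyz : y ≤ z) : f x * (z - y) + f z * (y - x) ≤ f y * (z - x) := by
  rcases hxy.eq_or_lt with rfl | hxy
  · linarith
  rcases hyz.eq_or_lt with rfl | hyz
  · linarith
  have h := hf.slope_anti_adjacent (Set.mem_univ x) (Set.mem_univ z) hxy hyz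
  rw [div_le_div_iff₀ (by linarith) (by linarith)] at h
  nlinarith

/-- The lower Hermite–Hadamard inequality for a continuous concave function. -/
theorem ConcaveOn.trapezoid_le_integral {f : ℝ → ℝ} (hf : ConcaveOn ℝ Set.univ f)
    (hcont : Continuous f) {a b : ℝ} (hab : a < b) :
    (f a + f b) / 2 * (b - a) ≤ ∫ t in a..b, f t := by
  have hba : 0 < b - a := sub_pos.2 hab
  calc (f a + f b) / 2 * (b - a)
      = ∫ t in a..b, (f a + (f b - f a) / (b - a) * (t - a)) := by
        rw [integral_affine]
        field_simp
        ring
    _ ≤ ∫ t in a..b, f t := by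
        apply intervalIntegral.integral_mono_on hab.le
        · apply Continuous.intervalIntegrable; fun_prop
        · exact hcont.intervalIntegrable a b
        · intro t ht
          have h := hf.chord_mul_le ht.1 ht.2
          rw [← mul_le_mul_iff_left₀ hba]
          have : (f a + (f b - f a) / (b - a) * (t - a)) * (b - a)
              = f a * (b - a) + (f b - f a) * (t - a) := by
            field_simp
          linarith

/-- A differentiable function lying below the two legs of a triangle has an integral strictly
smaller than the area of the triangle. -/
theorem integral_lt_triangle_area {g : ℝ → ℝ} (hg : Differentiable ℝ g) {a b p q : ℝ}
    (hab : a < b) (hp : 0 < p) (hq : 0 < q)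
    (hgp : ∀ t ∈ Set.Icc a b, g t ≤ p * (t - a))
    (hgq : ∀ t ∈ Set.Icc a b, g t ≤ q * (b - t)) :
    ∫ t in a..b, g t < p * q / (p + q) * (b - a) ^ 2 / 2 := by
  have hba : 0 < b - a := sub_pos.2 hab
  obtain ⟨c, hc⟩ : ∃ c, c = a + q * (b - a) / (p + q) := ⟨_, rfl⟩
  have hca : c - a = q * (b - a) / (p + q) := by rw [hc]; ring
  have hbc : b - c = p * (b - a) / (p + q) := by rw [hc]; field_simp; ring
  have hac : a < c := sub_pos.1 (hca ▸ by positivity)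
  have hcb : c < b := sub_pos.1 (hbc ▸ by positivity)
  have hint : ∀ x y, IntervalIntegrable g MeasureTheory.volume x y :=
    fun x y => hg.continuous.intervalIntegrable x y
  have hapex : p * (c - a) = q * (b - c) := by rw [hca, hbc]; ring
  have hlt : g c < p * (c - a) := by
    refine lt_of_le_of_ne (hgp c ⟨hac.le, hcb.le⟩) fun heq => ?_
    have hderiv : ∀ m : ℝ, (∀ t ∈ Set.Icc a b, g t ≤ g c + m * (t - c)) → deriv g c = m := by
      intro m h
      have hmax : IsLocalMax (fun t => g t - m * (t - c)) c := by
        filter_upwards [Icc_mem_nhds hac hcb] with t ht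
        have := h t ht
        simp only [sub_self, mul_zero, sub_zero]
        linarith
      have hd : HasDerivAt (fun t => g t - m * (t - c)) (deriv g c - m * 1) c :=
        (hg c).hasDerivAt.sub (((hasDerivAt_id c).sub_const c).const_mul m)
      linarith [hmax.hasDerivAt_eq_zero hd]
    have h₁ := hderiv p fun t ht => by linarith [hgp t ht]
    have h₂ := hderiv (-q) fun t ht => by linarith [hgq t ht]
    linarith
  have hleft : ∫ t in a..c, g t < p * (c - a) ^ 2 / 2 := by
    calc ∫ t in a..c, g t < ∫ t in a..c, (0 + p * (t - a)) := by
          apply intervalIntegral.integral_lt_integral_of_continuousOn_of_le_of_exists_lt hac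
            hg.continuous.continuousOn (by fun_prop)
          · intro t ht
            linarith [hgp t ⟨ht.1.le, ht.2.trans hcb.le⟩]
          · exact ⟨c, ⟨hac.le, le_rfl⟩, by linarith⟩
      _ = p * (c - a) ^ 2 / 2 := by rw [integral_affine]; ring
  have hright : ∫ t in c..b, g t ≤ q * (b - c) ^ 2 / 2 := by
    calc ∫ t in c..b, g t ≤ ∫ t in c..b, (q * (b - c) + -q * (t - c)) := by
          apply intervalIntegral.integral_mono_on hcb.le (hint c b)
          · apply Continuous.intervalIntegrable; fun_prop
          · intro t ht
            linarith [hgq t ⟨hac.le.trans ht.1, ht.2⟩]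
      _ = q * (b - c) ^ 2 / 2 := by rw [integral_affine]; ring
  rw [← intervalIntegral.integral_add_adjacent_intervals (hint a c) (hint c b)]
  have harea : p * (c - a) ^ 2 / 2 + q * (b - c) ^ 2 / 2
      = p * q / (p + q) * (b - a) ^ 2 / 2 := by
    rw [hca, hbc]
    field_simp
    ring
  linarith

/-- Lemma 5.8 of the paper: for a concave `C¹` function `f` vanishing at `α₀ < β₀` and
positive in between, the ratio `a(s)/d(s)²` of the area above height `s` to the square
of the chord length at height `s` is strictly decreasing in `s`. -/
theorem area_over_chord_sq_strictly_decreasing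
    (f : ℝ → ℝ) (hconc : ConcaveOn ℝ Set.univ f) (hC1 : ContDiff ℝ 1 f)
    (α₀ β₀ : ℝ) (hαβ : α₀ < β₀) (hfα₀ : f α₀ = 0) (hfβ₀ : f β₀ = 0)
    (hfpos : ∀ t ∈ Set.Ioo α₀ β₀, 0 < f t)
    (s₁ s₂ : ℝ) (hs₁ : 0 ≤ s₁) (hs₁₂ : s₁ < s₂) (hs₂ : s₂ < ⨆ t, f t)
    (α₁ β₁ α₂ β₂ : ℝ) (hab₁ : α₁ < β₁) (hab₂ : α₂ < β₂)
    (hα₁ : α₁ ∈ Set.Icc α₀ β₀) (hβ₁ : β₁ ∈ Set.Icc α₀ β₀)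
    (hα₂ : α₂ ∈ Set.Icc α₀ β₀) (hβ₂ : β₂ ∈ Set.Icc α₀ β₀)
    (hfα₁ : f α₁ = s₁) (hfβ₁ : f β₁ = s₁) (hgt₁ : ∀ t ∈ Set.Ioo α₁ β₁, s₁ < f t)
    (hfα₂ : f α₂ = s₂) (hfβ₂ : f β₂ = s₂) (hgt₂ : ∀ t ∈ Set.Ioo α₂ β₂, s₂ < f t) :
    (∫ t in α₂..β₂, (f t - s₂)) / (β₂ - α₂) ^ 2 <
      (∫ t in α₁..β₁, (f t - s₁)) / (β₁ - α₁) ^ 2 := by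
  have hcont : Continuous f := hC1.continuous
  have hα : α₁ < α₂ := by
    by_contra! h
    have := hconc.chord_mul_le h hab₁.le
    rw [hfα₁, hfβ₁, hfα₂] at this
    nlinarith
  have hβ : β₂ < β₁ := by
    by_contra! h
    have := hconc.chord_mul_le hab₁.le h
    rw [hfα₁, hfβ₁, hfβ₂] at this
    nlinarith
  have hα' : 0 < α₂ - α₁ := sub_pos.2 hα
  have hβ' : 0 < β₁ - β₂ := sub_pos.2 hβ
  have hs : 0 < s₂ - s₁ := sub_pos.2 hs₁₂
  have hd₂ : 0 < β₂ - α₂ := sub_pos.2 hab₂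
  have hd₁ : 0 < β₁ - α₁ := sub_pos.2 hab₁
  have hupper : ∫ t in α₂..β₂, (f t - s₂) <
      (s₂ - s₁) / (α₂ - α₁ + (β₁ - β₂)) * (β₂ - α₂) ^ 2 / 2 := by
    convert integral_lt_triangle_area (g := fun t => f t - s₂)
      ((hC1.differentiable one_ne_zero).sub_const s₂) hab₂ (div_pos hs hα') (div_pos hs hβ')
      (fun t ht => ?_) (fun t ht => ?_) using 3
    · field_simp
      ring
    · have := hconc.chord_mul_le hα.le ht.1
      rw [hfα₁, hfα₂] at this
      rw [div_mul_eq_mul_div, le_div_iff₀ hα']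
      linarith
    · have := hconc.chord_mul_le ht.2 hβ.le
      rw [hfβ₁, hfβ₂] at this
      rw [div_mul_eq_mul_div, le_div_iff₀ hβ']
      linarith
  have hlower : (∫ t in α₂..β₂, (f t - s₂)) + (s₂ - s₁) * (β₁ - α₁ + (β₂ - α₂)) / 2 ≤
      ∫ t in α₁..β₁, (f t - s₁) := by
    have hint : ∀ x y, IntervalIntegrable f MeasureTheory.volume x y := hcont.intervalIntegrable
    have hconst : ∀ s x y, ∫ t in x..y, (f t - s) = (∫ t in x..y, f t) - (y - x) * s := by
      intro s x y
      rw [intervalIntegral.integral_sub (hint x y) (by simp), intervalIntegral.integral_const,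
        smul_eq_mul]
    have hleft := hconc.trapezoid_le_integral hcont hα
    have hright := hconc.trapezoid_le_integral hcont hβ
    rw [hfα₁, hfα₂] at hleft
    rw [hfβ₁, hfβ₂] at hright
    rw [hconst, hconst,
      ← intervalIntegral.integral_add_adjacent_intervals (hint α₁ α₂) (hint α₂ β₁),
      ← intervalIntegral.integral_add_adjacent_intervals (hint α₂ β₂) (hint β₂ β₁)]
    linarith
  rw [div_mul_eq_mul_div, div_div, lt_div_iff₀ (by positivity)] at hupper
  rw [div_lt_div_iff₀ (by positivity) (by positivity)]
  have hsum : 0 < β₁ - α₁ + (β₂ - α₂) := by positivity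
  have hmul := mul_lt_mul_of_pos_right hupper hsum
  have hmul' := mul_le_mul_of_nonneg_right hlower (sq_nonneg (β₂ - α₂))
  linarith
end

section
/- Let ‖·‖ be a norm on ℝ^k and ‖·‖_* its dual norm. Then ‖·‖ is strongly convex (i.e. there exists α > 0 such that ‖tx+(1−t)y‖² ≤ t‖x‖² + (1−t)‖y‖² − (α/2)t(1−t)‖x−y‖² for all x,y ∈ ℝ^k and t ∈ [0,1]) if and only if ‖·‖_* is a C^{1,1} norm, i.e. ‖·‖_* is differentiable on ℝ^k∖{0} with derivative locally Lipschitz on ℝ^k∖{0} (equivalently, Lipschitz on the dual unit sphere). -/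
/-- A (symmetric) norm on `ℝ^k = EuclideanSpace ℝ (Fin k)`. -/
structure IsNormE {k : ℕ} (nrm : EuclideanSpace ℝ (Fin k) → ℝ) : Prop where
  eq_zero_iff : ∀ x, nrm x = 0 ↔ x = 0
  smul_eq : ∀ (a : ℝ) (x : EuclideanSpace ℝ (Fin k)), nrm (a • x) = |a| * nrm x
  triangle : ∀ x y, nrm (x + y) ≤ nrm x + nrm y

/-- The dual norm of `nrm`, seen as a function on `ℝ^k` via the Euclidean pairing. -/
noncomputable def dualNormV {k : ℕ} (nrm : EuclideanSpace ℝ (Fin k) → ℝ)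
    (q : EuclideanSpace ℝ (Fin k)) : ℝ :=
  sSup {r | ∃ u, nrm u ≤ 1 ∧ r = ∑ i, q i * u i}

/-- `nrm` is strongly convex: its square is strongly convex w.r.t. `nrm` itself. -/
def IsStronglyConvexNorm {k : ℕ} (nrm : EuclideanSpace ℝ (Fin k) → ℝ) : Prop :=
  ∃ α > (0:ℝ), ∀ x y : EuclideanSpace ℝ (Fin k), ∀ t ∈ Set.Icc (0:ℝ) 1,
    nrm (t • x + (1 - t) • y) ^ 2 ≤
      t * nrm x ^ 2 + (1 - t) * nrm y ^ 2 - (α / 2) * t * (1 - t) * nrm (x - y) ^ 2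

/-- `g` is a `C^{1,1}` function on `ℝ^k ∖ {0}`: differentiable there, with locally
Lipschitz derivative. -/
def IsC11AwayE {k : ℕ} (g : EuclideanSpace ℝ (Fin k) → ℝ) : Prop :=
  DifferentiableOn ℝ g {q | q ≠ 0} ∧
    ∀ q : EuclideanSpace ℝ (Fin k), q ≠ 0 → ∃ ε > (0:ℝ), ∃ K : NNReal,
      LipschitzOnWith K (fderiv ℝ g) (Metric.ball q ε \ {0})

open Metric
open scoped RealInnerProductSpace

namespace IsNormE

variable {k : ℕ} {nrm : EuclideanSpace ℝ (Fin k) → ℝ}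

theorem map_zero (h : IsNormE nrm) : nrm 0 = 0 := (h.eq_zero_iff 0).2 rfl

theorem map_neg (h : IsNormE nrm) (x : EuclideanSpace ℝ (Fin k)) : nrm (-x) = nrm x := by
  simpa using h.smul_eq (-1) x

theorem nonneg (h : IsNormE nrm) (x : EuclideanSpace ℝ (Fin k)) : 0 ≤ nrm x := by
  have := h.triangle x (-x)
  rw [add_neg_cancel, h.map_zero, h.map_neg] at this
  linarith

theorem pos (h : IsNormE nrm) {x : EuclideanSpace ℝ (Fin k)} (hx : x ≠ 0) : 0 < nrm x :=
  (h.nonneg x).lt_of_ne' (mt (h.eq_zero_iff x).1 hx)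

theorem continuous (h : IsNormE nrm) : Continuous nrm := by
  have hconv : ConvexOn ℝ Set.univ nrm := by
    refine ⟨convex_univ, fun x _ y _ a b ha hb _ => (h.triangle _ _).trans_eq ?_⟩
    rw [h.smul_eq, h.smul_eq, abs_of_nonneg ha, abs_of_nonneg hb, smul_eq_mul, smul_eq_mul]
  exact hconv.locallyLipschitz.continuous

theorem eq_norm_mul (h : IsNormE nrm) {x : EuclideanSpace ℝ (Fin k)} (hx : x ≠ 0) :
    nrm x = ‖x‖ * nrm (‖x‖⁻¹ • x) := by
  rw [h.smul_eq, abs_of_nonneg (by positivity), mul_inv_cancel_left₀ (norm_ne_zero_iff.2 hx)]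

theorem exists_le_mul_norm (h : IsNormE nrm) : ∃ C > (0 : ℝ), ∀ x, nrm x ≤ C * ‖x‖ := by
  obtain ⟨C, hC⟩ := (isCompact_sphere (0 : EuclideanSpace ℝ (Fin k)) 1).bddAbove_image
    h.continuous.continuousOn
  refine ⟨max C 1, by positivity, fun x => ?_⟩
  rcases eq_or_ne x 0 with rfl | hx
  · simp [h.map_zero]
  · rw [h.eq_norm_mul hx, mul_comm]
    gcongr
    refine (hC (Set.mem_image_of_mem _ ?_)).trans (le_max_left _ _)
    simp [norm_smul, hx]

theorem exists_mul_norm_le (h : IsNormE nrm) : ∃ c > (0 : ℝ), ∀ x, c * ‖x‖ ≤ nrm x := by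
  rcases (sphere (0 : EuclideanSpace ℝ (Fin k)) 1).eq_empty_or_nonempty with he | hne
  · refine ⟨1, one_pos, fun x => ?_⟩
    rcases eq_or_ne x 0 with rfl | hx
    · simp [h.map_zero]
    · have : ‖x‖⁻¹ • x ∈ sphere (0 : EuclideanSpace ℝ (Fin k)) 1 := by simp [norm_smul, hx]
      simp [he] at this
  · obtain ⟨z, hz, hmin⟩ := (isCompact_sphere (0 : EuclideanSpace ℝ (Fin k)) 1).exists_isMinOn
      hne h.continuous.continuousOn
    have hz0 : z ≠ 0 := by
      rintro rfl
      simp at hz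
    refine ⟨nrm z, h.pos hz0, fun x => ?_⟩
    rcases eq_or_ne x 0 with rfl | hx
    · simp [h.map_zero]
    · rw [h.eq_norm_mul hx, mul_comm]
      gcongr
      exact hmin (by simp [norm_smul, hx])

/-- The supremum defining the dual norm is attained. -/
theorem exists_isGreatest_dualNormV (h : IsNormE nrm) (q : EuclideanSpace ℝ (Fin k)) :
    ∃ u, nrm u ≤ 1 ∧ ⟪q, u⟫ = dualNormV nrm q ∧ ∀ v, nrm v ≤ 1 → ⟪q, v⟫ ≤ dualNormV nrm q := by
  obtain ⟨c, hc, hle⟩ := h.exists_mul_norm_le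
  have hcpt : IsCompact {u | nrm u ≤ 1} := by
    refine (isCompact_closedBall (0 : EuclideanSpace ℝ (Fin k)) c⁻¹).of_isClosed_subset
      (isClosed_le h.continuous continuous_const) fun u hu => ?_
    rw [mem_closedBall_zero_iff, ← one_div, le_div_iff₀' hc]
    exact (hle u).trans hu
  obtain ⟨u, hu, hmax⟩ := hcpt.exists_isMaxOn ⟨0, by simp [h.map_zero]⟩
    (f := fun u => ⟪q, u⟫) (by fun_prop)
  have hsum (v : EuclideanSpace ℝ (Fin k)) : ∑ i, q i * v i = ⟪q, v⟫ := by
    simp [PiLp.inner_apply, mul_comm]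
  have hD : dualNormV nrm q = ⟪q, u⟫ := by
    refine IsGreatest.csSup_eq ⟨⟨u, hu, (hsum u).symm⟩, ?_⟩
    rintro _ ⟨v, hv, rfl⟩
    rw [hsum]
    exact hmax hv
  exact ⟨u, hu, hD.symm, fun v hv => hD ▸ hmax hv⟩

theorem inner_le_dualNormV_mul (h : IsNormE nrm) (q v : EuclideanSpace ℝ (Fin k)) :
    ⟪q, v⟫ ≤ dualNormV nrm q * nrm v := by
  obtain ⟨-, -, -, hle⟩ := h.exists_isGreatest_dualNormV q
  rcases eq_or_ne v 0 with rfl | hv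
  · simp [h.map_zero]
  · have hpos := h.pos hv
    have := hle ((nrm v)⁻¹ • v) (by
      rw [h.smul_eq, abs_of_pos (by positivity), inv_mul_cancel₀ hpos.ne'])
    rwa [real_inner_smul_right, inv_mul_le_iff₀ hpos, mul_comm] at this

theorem dualNormV_le (h : IsNormE nrm) {q : EuclideanSpace ℝ (Fin k)} {r : ℝ}
    (hr : ∀ v, nrm v ≤ 1 → ⟪q, v⟫ ≤ r) : dualNormV nrm q ≤ r := by
  obtain ⟨u, hu, hq, -⟩ := h.exists_isGreatest_dualNormV q
  exact hq ▸ hr u hu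

theorem dualNormV_nonneg (h : IsNormE nrm) (q : EuclideanSpace ℝ (Fin k)) :
    0 ≤ dualNormV nrm q := by
  obtain ⟨-, -, -, hle⟩ := h.exists_isGreatest_dualNormV q
  simpa using hle 0 (by simp [h.map_zero])

/-- The dual norm is a norm. -/
theorem dual (h : IsNormE nrm) : IsNormE (dualNormV nrm) where
  eq_zero_iff q := by
    constructor
    · intro hq
      have := h.inner_le_dualNormV_mul q q
      rw [hq, zero_mul] at this
      exact real_inner_self_nonpos.1 this
    · rintro rfl
      exact (h.dualNormV_le fun v _ => by simp).antisymm (h.dualNormV_nonneg 0)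
  smul_eq := by
    have hle (a : ℝ) (q : EuclideanSpace ℝ (Fin k)) :
        dualNormV nrm (a • q) ≤ |a| * dualNormV nrm q := by
      refine h.dualNormV_le fun v hv => ?_
      rw [real_inner_smul_left, ← real_inner_smul_right]
      refine (h.inner_le_dualNormV_mul q _).trans ?_
      rw [h.smul_eq, mul_comm]
      have := h.dualNormV_nonneg q
      gcongr
      exact mul_le_of_le_one_right (abs_nonneg a) hv
    intro a q
    refine (hle a q).antisymm ?_
    rcases eq_or_ne a 0 with rfl | ha
    · simpa using h.dualNormV_nonneg _
    · have := hle a⁻¹ (a • q)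
      rwa [inv_smul_smul₀ ha, abs_inv, ← div_eq_inv_mul, le_div_iff₀' (abs_pos.2 ha)] at this
  triangle p q := h.dualNormV_le fun v hv => by
    obtain ⟨-, -, -, hp⟩ := h.exists_isGreatest_dualNormV p
    obtain ⟨-, -, -, hq⟩ := h.exists_isGreatest_dualNormV q
    rw [inner_add_left]
    exact add_le_add (hp v hv) (hq v hv)

theorem exists_dualNormV_attained (h : IsNormE nrm) {q : EuclideanSpace ℝ (Fin k)} (hq : q ≠ 0) :
    ∃ u, nrm u = 1 ∧ ⟪q, u⟫ = dualNormV nrm q := by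
  obtain ⟨u, hu, hqu, -⟩ := h.exists_isGreatest_dualNormV q
  refine ⟨u, hu.antisymm ?_, hqu⟩
  have := h.inner_le_dualNormV_mul q u
  rwa [hqu, le_mul_iff_one_le_right (h.dual.pos hq)] at this

/-- Hahn–Banach: every vector is normed by a functional of dual norm at most one. -/
theorem exists_norming (h : IsNormE nrm) {z : EuclideanSpace ℝ (Fin k)} (hz : z ≠ 0) :
    ∃ q, dualNormV nrm q ≤ 1 ∧ ⟪q, z⟫ = nrm z := by
  obtain ⟨g, hg, hle⟩ := exists_extension_of_le_sublinear
    (LinearPMap.mkSpanSingleton (σ := RingHom.id ℝ) z (nrm z) hz) nrm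
    (fun c hc x => by rw [h.smul_eq, abs_of_pos hc]) h.triangle (by
      rintro ⟨x, hx⟩
      obtain ⟨c, rfl⟩ := Submodule.mem_span_singleton.1 hx
      rw [LinearPMap.mkSpanSingleton'_apply, h.smul_eq]
      exact mul_le_mul_of_nonneg_right (le_abs_self c) (h.nonneg z))
  have hgz : g z = nrm z := by
    rw [← LinearPMap.mkSpanSingleton_apply (σ := RingHom.id ℝ) ℝ ℝ hz (nrm z)]
    exact hg ⟨z, Submodule.mem_span_singleton_self z⟩
  set q := (InnerProductSpace.toDual ℝ (EuclideanSpace ℝ (Fin k))).symm g.toContinuousLinearMap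
  have hq (v : EuclideanSpace ℝ (Fin k)) : ⟪q, v⟫ = g v := by simp [q]
  exact ⟨q, h.dualNormV_le fun v hv => (hq v).trans_le ((hle v).trans hv), (hq z).trans hgz⟩

theorem abs_sub_le (h : IsNormE nrm) (x y : EuclideanSpace ℝ (Fin k)) :
    |nrm x - nrm y| ≤ nrm (x - y) := by
  have h₁ := h.triangle (x - y) y
  have h₂ := h.triangle (y - x) x
  rw [sub_add_cancel] at h₁ h₂
  rw [← neg_sub x y, h.map_neg] at h₂
  rw [_root_.abs_le]
  constructor <;> linarith

/-- Strong convexity forces `⟪q, ·⟫ - nrm ^ 2 / 2` to decay quadratically away from its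
maximizer. -/
theorem quadratic_growth (h : IsNormE nrm) {α : ℝ}
    (hα : ∀ x y : EuclideanSpace ℝ (Fin k), ∀ t ∈ Set.Icc (0 : ℝ) 1,
      nrm (t • x + (1 - t) • y) ^ 2 ≤
        t * nrm x ^ 2 + (1 - t) * nrm y ^ 2 - (α / 2) * t * (1 - t) * nrm (x - y) ^ 2)
    {q x : EuclideanSpace ℝ (Fin k)} (hx : nrm x = dualNormV nrm q)
    (hqx : ⟪q, x⟫ = dualNormV nrm q ^ 2) (y : EuclideanSpace ℝ (Fin k)) :
    ⟪q, y⟫ - nrm y ^ 2 / 2 + α / 8 * nrm (y - x) ^ 2 ≤ dualNormV nrm q ^ 2 / 2 := by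
  have hmid := hα y x (1 / 2) ⟨by norm_num, by norm_num⟩
  have hle := h.inner_le_dualNormV_mul q ((1 / 2 : ℝ) • y + (1 - 1 / 2 : ℝ) • x)
  have hsq := two_mul_le_add_sq (dualNormV nrm q) (nrm ((1 / 2 : ℝ) • y + (1 - 1 / 2 : ℝ) • x))
  rw [inner_add_right, real_inner_smul_right, real_inner_smul_right, hqx] at hle
  rw [hx] at hmid
  linarith

/-- For a strongly convex norm, the unit vectors norming `q` depend on `q` in a locally
Lipschitz way. -/
theorem exists_maximizer_lipschitz (h : IsNormE nrm) (hsc : IsStronglyConvexNorm nrm) :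
    ∃ K > (0 : ℝ), ∀ q q' u u' : EuclideanSpace ℝ (Fin k),
      nrm u = 1 → ⟪q, u⟫ = dualNormV nrm q → nrm u' = 1 → ⟪q', u'⟫ = dualNormV nrm q' →
      dualNormV nrm q * ‖u' - u‖ ≤ K * ‖q' - q‖ := by
  obtain ⟨α, hα, hconv⟩ := hsc
  obtain ⟨c, hc, hcle⟩ := h.exists_mul_norm_le
  obtain ⟨C, hC, hCle⟩ := h.dual.exists_le_mul_norm
  refine ⟨(α / 4 * c ^ 2)⁻¹ + C * c⁻¹, by positivity, fun q q' u u' hu hqu hu' hqu' => ?_⟩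
  set D := dualNormV nrm q with hD
  set D' := dualNormV nrm q' with hD'
  have hD0 : 0 ≤ D := h.dualNormV_nonneg q
  have hD0' : 0 ≤ D' := h.dualNormV_nonneg q'
  have hx : nrm (D • u) = D := by rw [h.smul_eq, hu, abs_of_nonneg hD0, mul_one]
  have hx' : nrm (D' • u') = D' := by rw [h.smul_eq, hu', abs_of_nonneg hD0', mul_one]
  have hqx : ⟪q, D • u⟫ = D ^ 2 := by rw [real_inner_smul_right, hqu, sq]
  have hqx' : ⟪q', D' • u'⟫ = D' ^ 2 := by rw [real_inner_smul_right, hqu', sq]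
  have hmono : α / 4 * nrm (D' • u' - D • u) ^ 2 ≤ ⟪q' - q, D' • u' - D • u⟫ := by
    have h₁ := h.quadratic_growth hconv hx hqx (D' • u')
    have h₂ := h.quadratic_growth hconv hx' hqx' (D • u)
    rw [← neg_sub (D' • u'), h.map_neg] at h₂
    rw [hx', ← hD] at h₁
    rw [hx, ← hD'] at h₂
    rw [inner_sub_left, inner_sub_right, inner_sub_right, hqx, hqx']
    linarith
  have hxx : ‖D' • u' - D • u‖ ≤ (α / 4 * c ^ 2)⁻¹ * ‖q' - q‖ := by
    rw [← div_eq_inv_mul, le_div_iff₀' (by positivity)]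
    have hle : α / 4 * c ^ 2 * ‖D' • u' - D • u‖ * ‖D' • u' - D • u‖
        ≤ ‖q' - q‖ * ‖D' • u' - D • u‖ :=
      calc _ = α / 4 * (c * ‖D' • u' - D • u‖) ^ 2 := by ring
        _ ≤ α / 4 * nrm (D' • u' - D • u) ^ 2 := by gcongr; exact hcle _
        _ ≤ _ := hmono.trans (real_inner_le_norm _ _)
    rcases (norm_nonneg (D' • u' - D • u)).eq_or_lt with h0 | h0
    · rw [← h0, mul_zero]
      exact norm_nonneg _
    · exact le_of_mul_le_mul_right hle h0
  have hDD : |D' - D| ≤ C * ‖q' - q‖ := (h.dual.abs_sub_le q' q).trans (hCle _)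
  have hu'c : ‖u'‖ ≤ c⁻¹ := by
    rw [← one_div, le_div_iff₀' hc]
    exact (hcle u').trans_eq hu'
  calc D * ‖u' - u‖ = ‖(D' • u' - D • u) - (D' - D) • u'‖ := by
        rw [← abs_of_nonneg hD0, ← Real.norm_eq_abs, ← norm_smul, Real.norm_eq_abs,
          abs_of_nonneg hD0]
        congr 1
        module
    _ ≤ ‖D' • u' - D • u‖ + |D' - D| * ‖u'‖ := by
        rw [← Real.norm_eq_abs, ← norm_smul]
        exact norm_sub_le _ _
    _ ≤ (α / 4 * c ^ 2)⁻¹ * ‖q' - q‖ + C * ‖q' - q‖ * c⁻¹ := by gcongr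
    _ = _ := by ring

theorem hasFDerivAt_dualNormV (h : IsNormE nrm) (hsc : IsStronglyConvexNorm nrm)
    {q u : EuclideanSpace ℝ (Fin k)} (hq : q ≠ 0) (hu : nrm u = 1)
    (hqu : ⟪q, u⟫ = dualNormV nrm q) : HasFDerivAt (dualNormV nrm) (innerSL ℝ u) q := by
  obtain ⟨K, hK, hlip⟩ := h.exists_maximizer_lipschitz hsc
  have hD := h.dual.pos hq
  refine HasFDerivAt.of_isLittleO (Asymptotics.IsBigO.trans_isLittleO
    (g := fun q' => ‖q' - q‖ ^ 2) ?_ (Asymptotics.isLittleO_pow_sub_sub q one_lt_two))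
  refine Asymptotics.IsBigO.of_bound (K / dualNormV nrm q) ?_
  filter_upwards [isOpen_ne.mem_nhds hq] with q' hq'
  obtain ⟨u', hu', hqu'⟩ := h.exists_dualNormV_attained hq'
  have hle := h.inner_le_dualNormV_mul q' u
  have hle' := h.inner_le_dualNormV_mul q u'
  have huu : ‖u' - u‖ ≤ K / dualNormV nrm q * ‖q' - q‖ := by
    rw [div_mul_eq_mul_div, le_div_iff₀' hD]
    exact hlip q q' u u' hu hqu hu' hqu'
  have hcs := (real_inner_le_norm (u' - u) (q' - q)).trans
    (mul_le_mul_of_nonneg_right huu (norm_nonneg _))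
  rw [hu, mul_one, real_inner_comm] at hle
  rw [hu', mul_one, real_inner_comm] at hle'
  rw [real_inner_comm] at hqu hqu'
  rw [innerSL_apply_apply, Real.norm_eq_abs, Real.norm_of_nonneg (by positivity),
    abs_of_nonneg (by rw [inner_sub_right]; linarith)]
  simp only [inner_sub_left, inner_sub_right] at hcs ⊢
  linarith

theorem dual_isC11AwayE (h : IsNormE nrm) (hsc : IsStronglyConvexNorm nrm) :
    IsC11AwayE (dualNormV nrm) := by
  refine ⟨fun q hq => ?_, fun q₀ hq₀ => ?_⟩
  · obtain ⟨u, hu, hqu⟩ := h.exists_dualNormV_attained hq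
    exact (h.hasFDerivAt_dualNormV hsc hq hu hqu).differentiableAt.differentiableWithinAt
  obtain ⟨K, hK, hlip⟩ := h.exists_maximizer_lipschitz hsc
  have hD₀ := h.dual.pos hq₀
  obtain ⟨ε, hε, hball⟩ := Metric.mem_nhds_iff.1
    ((isOpen_lt continuous_const h.dual.continuous).mem_nhds (half_lt_self hD₀))
  refine ⟨ε, hε, (K / (dualNormV nrm q₀ / 2)).toNNReal,
    LipschitzOnWith.of_dist_le_mul fun q' hq' q hq => ?_⟩
  obtain ⟨u, hu, hqu⟩ := h.exists_dualNormV_attained hq.2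
  obtain ⟨u', hu', hqu'⟩ := h.exists_dualNormV_attained hq'.2
  rw [(h.hasFDerivAt_dualNormV hsc hq.2 hu hqu).fderiv,
    (h.hasFDerivAt_dualNormV hsc hq'.2 hu' hqu').fderiv, dist_eq_norm, dist_eq_norm, ← map_sub,
    innerSL_apply_norm, Real.coe_toNNReal _ (by positivity), div_mul_eq_mul_div,
    le_div_iff₀' (by positivity)]
  refine le_trans ?_ (hlip q q' u u' hu hqu hu' hqu')
  gcongr
  exact (hball hq.1).le

theorem fderiv_dualNormV (h : IsNormE nrm) {q u : EuclideanSpace ℝ (Fin k)}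
    (hd : DifferentiableAt ℝ (dualNormV nrm) q) (hu : nrm u = 1)
    (hqu : ⟪q, u⟫ = dualNormV nrm q) : fderiv ℝ (dualNormV nrm) q = innerSL ℝ u := by
  have hmin : IsLocalMin (fun p => dualNormV nrm p - innerSL ℝ u p) q := by
    refine Filter.Eventually.of_forall fun p => ?_
    have := h.inner_le_dualNormV_mul p u
    rw [hu] at this
    simp only [innerSL_apply_apply]
    rw [real_inner_comm p u, real_inner_comm q u, hqu]
    linarith
  exact sub_eq_zero.1 (hmin.hasFDerivAt_eq_zero (hd.hasFDerivAt.sub (innerSL ℝ u).hasFDerivAt))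

/-- Near a nonzero point, a `C^{1,1}` dual norm lies below its tangents up to a quadratic
error. -/
theorem exists_local_quadratic_upper_bound (h : IsNormE nrm) (hC : IsC11AwayE (dualNormV nrm))
    {q₀ : EuclideanSpace ℝ (Fin k)} (hq₀ : q₀ ≠ 0) :
    ∃ ε > (0 : ℝ), ∃ L : ℝ, ∀ q ∈ ball q₀ ε, ∀ u, nrm u = 1 → ⟪q, u⟫ = dualNormV nrm q →
      ∀ s, dualNormV nrm (q + s) ≤ dualNormV nrm q + ⟪s, u⟫ + L * ‖s‖ ^ 2 := by
  obtain ⟨hdiff, hlip⟩ := hC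
  obtain ⟨ε, hε, K, hK⟩ := hlip q₀ hq₀
  obtain ⟨C, hC, hCle⟩ := h.dual.exists_le_mul_norm
  have hδ : 0 < min ε ‖q₀‖ := lt_min hε (norm_pos_iff.2 hq₀)
  set δ := min ε ‖q₀‖
  have hsub : ball q₀ δ ⊆ ball q₀ ε \ {0} := by
    refine fun p hp => ⟨ball_subset_ball (min_le_left _ _) hp, ?_⟩
    rintro rfl
    rw [mem_ball, dist_zero_left] at hp
    exact (hp.trans_le (min_le_right _ _)).false
  have hdiffAt (p : EuclideanSpace ℝ (Fin k)) (hp : p ∈ ball q₀ δ) :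
      DifferentiableAt ℝ (dualNormV nrm) p :=
    hdiff.differentiableAt (isOpen_ne.mem_nhds (hsub hp).2)
  refine ⟨δ / 2, by positivity, K + 2 * C / (δ / 2), fun q hq u hu hqu s => ?_⟩
  have hqδ : q ∈ ball q₀ δ := ball_subset_ball (by linarith) hq
  rcases lt_or_ge ‖s‖ (δ / 2) with hs | hs
  · have hball : closedBall q ‖s‖ ⊆ ball q₀ δ := by
      intro p hp
      rw [mem_ball] at hq ⊢
      rw [mem_closedBall] at hp
      linarith [dist_triangle p q q₀]
    have hmv := Convex.norm_image_sub_le_of_norm_fderiv_le' (𝕜 := ℝ) (f := dualNormV nrm)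
      (φ := fderiv ℝ (dualNormV nrm) q) (C := K * ‖s‖) (s := closedBall q ‖s‖) (x := q)
      (y := q + s) (fun p hp => hdiffAt p (hball hp))
      (fun p hp => by
        refine (hK.norm_sub_le (hsub (hball hp)) (hsub hqδ)).trans ?_
        gcongr
        rwa [mem_closedBall, dist_eq_norm] at hp)
      (convex_closedBall _ _) (by simp) (by simp)
    rw [h.fderiv_dualNormV (hdiffAt q hqδ) hu hqu, add_sub_cancel_left, innerSL_apply_apply,
      real_inner_comm] at hmv
    have hmv' := (le_abs_self _).trans hmv
    have : 0 ≤ 2 * C / (δ / 2) * ‖s‖ ^ 2 := by positivity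
    linarith
  · have h₁ := h.dual.triangle q s
    have h₂ := h.inner_le_dualNormV_mul (-s) u
    rw [inner_neg_left, h.dual.map_neg, hu, mul_one] at h₂
    have h₃ := hCle s
    have h₄ : 2 * C * ‖s‖ ≤ 2 * C / (δ / 2) * ‖s‖ ^ 2 := by
      rw [div_mul_eq_mul_div, le_div_iff₀ (by positivity), sq, ← mul_assoc]
      gcongr
    have h₅ : 0 ≤ K * ‖s‖ ^ 2 := by positivity
    linarith

theorem exists_quadratic_upper_bound_sphere (h : IsNormE nrm)
    (hC : IsC11AwayE (dualNormV nrm)) :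
    ∃ L : ℝ, ∀ q ∈ sphere (0 : EuclideanSpace ℝ (Fin k)) 1, ∀ u, nrm u = 1 →
      ⟪q, u⟫ = dualNormV nrm q →
      ∀ s, dualNormV nrm (q + s) ≤ dualNormV nrm q + ⟪s, u⟫ + L * ‖s‖ ^ 2 := by
  refine (isCompact_sphere (0 : EuclideanSpace ℝ (Fin k)) 1).induction_on
    (p := fun S => ∃ L : ℝ, ∀ q ∈ S, ∀ u, nrm u = 1 → ⟪q, u⟫ = dualNormV nrm q →
      ∀ s, dualNormV nrm (q + s) ≤ dualNormV nrm q + ⟪s, u⟫ + L * ‖s‖ ^ 2)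
    ⟨0, by simp⟩ ?_ ?_ ?_
  · rintro S T hST ⟨L, hL⟩
    exact ⟨L, fun q hq => hL q (hST hq)⟩
  · rintro S T ⟨L, hL⟩ ⟨M, hM⟩
    refine ⟨max L M, ?_⟩
    rintro q (hq | hq) u hu hqu s
    · refine (hL q hq u hu hqu s).trans ?_
      gcongr
      exact le_max_left _ _
    · refine (hM q hq u hu hqu s).trans ?_
      gcongr
      exact le_max_right _ _
  · intro q hq
    have hq0 : q ≠ 0 := by
      rintro rfl
      simp at hq
    obtain ⟨ε, hε, hL⟩ := h.exists_local_quadratic_upper_bound hC hq0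
    exact ⟨ball q ε, mem_nhdsWithin_of_mem_nhds (ball_mem_nhds q hε), hL⟩

/-- The square of a `C^{1,1}` dual norm lies below its tangents up to a uniform quadratic
error. -/
theorem exists_sq_quadratic_upper_bound (h : IsNormE nrm) (hC : IsC11AwayE (dualNormV nrm)) :
    ∃ L > (0 : ℝ), ∀ q u : EuclideanSpace ℝ (Fin k), q ≠ 0 → nrm u = 1 →
      ⟪q, u⟫ = dualNormV nrm q → ∀ s, dualNormV nrm (q + s) ^ 2 ≤
        dualNormV nrm q ^ 2 + 2 * dualNormV nrm q * ⟪s, u⟫ + L * ‖s‖ ^ 2 := by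
  obtain ⟨L, hL⟩ := h.exists_quadratic_upper_bound_sphere hC
  obtain ⟨C, hC, hCle⟩ := h.dual.exists_le_mul_norm
  refine ⟨2 * C * |L| + C ^ 2, by positivity, fun q u hq hu hqu s => ?_⟩
  have hr : 0 < ‖q‖ := norm_pos_iff.2 hq
  have hscale : ‖q‖ * (dualNormV nrm (q + s) - dualNormV nrm q - ⟪s, u⟫) ≤ L * ‖s‖ ^ 2 := by
    have := hL (‖q‖⁻¹ • q) (by simp [norm_smul, hq]) u hu
      (by rw [real_inner_smul_left, hqu, h.dual.smul_eq, abs_of_nonneg (by positivity)])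
      (‖q‖⁻¹ • s)
    rw [← smul_add, h.dual.smul_eq, h.dual.smul_eq, real_inner_smul_left, norm_smul, norm_inv,
      norm_norm, abs_of_nonneg (by positivity)] at this
    calc _ = ‖q‖ ^ 2 * (‖q‖⁻¹ * dualNormV nrm (q + s) - ‖q‖⁻¹ * dualNormV nrm q
            - ‖q‖⁻¹ * ⟪s, u⟫) := by field_simp
      _ ≤ ‖q‖ ^ 2 * (L * (‖q‖⁻¹ * ‖s‖) ^ 2) := by gcongr; linarith
      _ = _ := by field_simp
  have hgap : 0 ≤ dualNormV nrm (q + s) - dualNormV nrm q - ⟪s, u⟫ := by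
    have := h.inner_le_dualNormV_mul (q + s) u
    rw [inner_add_left, hqu, hu] at this
    linarith
  have hmain : dualNormV nrm q * (dualNormV nrm (q + s) - dualNormV nrm q - ⟪s, u⟫)
      ≤ C * |L| * ‖s‖ ^ 2 :=
    calc _ ≤ C * ‖q‖ * (dualNormV nrm (q + s) - dualNormV nrm q - ⟪s, u⟫) := by
          gcongr; exact hCle q
      _ = C * (‖q‖ * (dualNormV nrm (q + s) - dualNormV nrm q - ⟪s, u⟫)) := by ring
      _ ≤ C * (|L| * ‖s‖ ^ 2) := by
          refine mul_le_mul_of_nonneg_left (hscale.trans ?_) hC.le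
          gcongr
          exact le_abs_self L
      _ = _ := by ring
  have hsq : (dualNormV nrm (q + s) - dualNormV nrm q) ^ 2 ≤ (C * ‖s‖) ^ 2 := by
    have habs := h.dual.abs_sub_le (q + s) q
    rw [add_sub_cancel_left] at habs
    exact sq_le_sq.2 ((habs.trans (hCle s)).trans (le_abs_self _))
  linarith

/-- The square of the norm has a quadratic minorant at every point. -/
theorem exists_sq_quadratic_minorant (h : IsNormE nrm) (hC : IsC11AwayE (dualNormV nrm)) :
    ∃ m > (0 : ℝ), ∀ z : EuclideanSpace ℝ (Fin k), ∃ q, ∀ x,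
      nrm z ^ 2 + 2 * ⟪q, x - z⟫ + m * ‖x - z‖ ^ 2 ≤ nrm x ^ 2 := by
  obtain ⟨L, hL, hupper⟩ := h.exists_sq_quadratic_upper_bound hC
  obtain ⟨c, hc, hcle⟩ := h.exists_mul_norm_le
  refine ⟨min L⁻¹ (c ^ 2), by positivity, fun z => ?_⟩
  rcases eq_or_ne z 0 with rfl | hz
  · refine ⟨0, fun x => ?_⟩
    calc _ = min L⁻¹ (c ^ 2) * ‖x‖ ^ 2 := by simp [h.map_zero]
      _ ≤ c ^ 2 * ‖x‖ ^ 2 := by gcongr; exact min_le_right _ _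
      _ = (c * ‖x‖) ^ 2 := by ring
      _ ≤ _ := by gcongr; exact hcle x
  obtain ⟨p, hp, hpz⟩ := h.exists_norming hz
  have hN := h.pos hz
  have hp1 : dualNormV nrm p = 1 := by
    refine hp.antisymm ?_
    have := h.inner_le_dualNormV_mul p z
    rwa [hpz, le_mul_iff_one_le_left hN] at this
  have hp0 : p ≠ 0 := by
    rintro rfl
    simp [h.dual.map_zero] at hp1
  have hDq : dualNormV nrm (nrm z • p) = nrm z := by
    rw [h.dual.smul_eq, hp1, abs_of_pos hN, mul_one]
  refine ⟨nrm z • p, fun x => ?_⟩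
  have hup := hupper (nrm z • p) ((nrm z)⁻¹ • z) (smul_ne_zero hN.ne' hp0)
    (by rw [h.smul_eq, abs_of_pos (by positivity), inv_mul_cancel₀ hN.ne'])
    (by rw [hDq, real_inner_smul_left, real_inner_smul_right, hpz, inv_mul_cancel₀ hN.ne',
      mul_one]) (L⁻¹ • (x - z))
  have hle := h.inner_le_dualNormV_mul (nrm z • p + L⁻¹ • (x - z)) x
  have hsq := two_mul_le_add_sq (dualNormV nrm (nrm z • p + L⁻¹ • (x - z))) (nrm x)
  have hqz : ⟪nrm z • p, z⟫ = nrm z ^ 2 := by rw [real_inner_smul_left, hpz, sq]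
  have hinner : ⟪x - z, x⟫ = ‖x - z‖ ^ 2 + ⟪x - z, z⟫ := by
    rw [← real_inner_self_eq_norm_sq, ← inner_add_right, sub_add_cancel]
  rw [hDq, norm_smul, norm_inv, Real.norm_of_nonneg hL.le, real_inner_smul_left,
    real_inner_smul_right] at hup
  rw [inner_add_left, real_inner_smul_left (x - z), hinner] at hle
  have hup' : 2 * nrm z * (L⁻¹ * ((nrm z)⁻¹ * ⟪x - z, z⟫)) + L * (L⁻¹ * ‖x - z‖) ^ 2
      = 2 * (L⁻¹ * ⟪x - z, z⟫) + L⁻¹ * ‖x - z‖ ^ 2 := by field_simp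
  have hmin : min L⁻¹ (c ^ 2) * ‖x - z‖ ^ 2 ≤ L⁻¹ * ‖x - z‖ ^ 2 := by
    gcongr
    exact min_le_left _ _
  rw [inner_sub_right, hqz]
  linarith

theorem isStronglyConvexNorm (h : IsNormE nrm) (hC : IsC11AwayE (dualNormV nrm)) :
    IsStronglyConvexNorm nrm := by
  obtain ⟨m, hm, hminor⟩ := h.exists_sq_quadratic_minorant hC
  obtain ⟨C, hC, hCle⟩ := h.exists_le_mul_norm
  refine ⟨2 * (m / C ^ 2), by positivity, fun x y t ⟨ht0, ht1⟩ => ?_⟩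
  obtain ⟨q, hq⟩ := hminor (t • x + (1 - t) • y)
  have hx := mul_le_mul_of_nonneg_left (hq x) ht0
  have hy := mul_le_mul_of_nonneg_left (hq y) (sub_nonneg.2 ht1)
  have hxz : x - (t • x + (1 - t) • y) = (1 - t) • (x - y) := by module
  have hyz : y - (t • x + (1 - t) • y) = (-t) • (x - y) := by module
  rw [hxz, real_inner_smul_right, norm_smul, mul_pow, Real.norm_eq_abs, sq_abs] at hx
  rw [hyz, real_inner_smul_right, norm_smul, mul_pow, Real.norm_eq_abs, sq_abs] at hy
  have hnorm : m / C ^ 2 * nrm (x - y) ^ 2 ≤ m * ‖x - y‖ ^ 2 :=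
    calc _ ≤ m / C ^ 2 * (C * ‖x - y‖) ^ 2 := by
          gcongr
          · exact h.nonneg _
          · exact hCle _
      _ = _ := by field_simp
  have := mul_le_mul_of_nonneg_left hnorm (mul_nonneg ht0 (sub_nonneg.2 ht1))
  linarith

end IsNormE

/-- A norm is strongly convex if and only if its dual norm is `C^{1,1}` on
`ℝ^k ∖ {0}`. -/
theorem strongly_convex_iff_dual_C11
    (k : ℕ) (nrm : EuclideanSpace ℝ (Fin k) → ℝ) (h1 : IsNormE nrm) :
    IsStronglyConvexNorm nrm ↔ IsC11AwayE (dualNormV nrm) :=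
  ⟨h1.dual_isC11AwayE, h1.isStronglyConvexNorm⟩
end
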